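/- arXiv:1612.00736 — 2 statements merged into one kernel-verified Lean document; each statement's English description precedes it below -/
import Mathlib

section
/- For every w ∈ S_n, the number c_w of distinct parabolic double cosets of S_n whose minimal-length element is w is divisible by 2^{|floats(w)|}. -/
/-- The value of `w ∈ S_n` at the 1-indexed position `k` (so `permVal w k = w(k)` for
`1 ≤ k ≤ n`, and `permVal w k = k` otherwise). -/
def permVal {n : ℕ} (w : Equiv.Perm (Fin n)) (k : ℕ) : ℕ :=
  if h : 1 ≤ k ∧ k ≤ n then (w ⟨k - 1, by omega⟩ : ℕ) + 1 else k

/-- The adjacent transposition `s_i ∈ S_n`, swapping the 1-indexed positions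
`i` and `i + 1`. -/
def adjT (n : ℕ) (i : ℕ) : Equiv.Perm (Fin n) :=
  if h : 1 ≤ i ∧ i + 1 ≤ n then Equiv.swap ⟨i - 1, by omega⟩ ⟨i, by omega⟩ else 1

/-- The Young subgroup `W_I` of `S_n` generated by the adjacent transpositions `s_i`,
`i ∈ I`. -/
def youngSubgroup (n : ℕ) (I : Set ℕ) : Subgroup (Equiv.Perm (Fin n)) :=
  Subgroup.closure {x | ∃ i ∈ I, x = adjT n i}

/-- The parabolic double coset `W_I w W_J` in `S_n`. -/
def doubleCosetS (n : ℕ) (I : Set ℕ) (w : Equiv.Perm (Fin n)) (J : Set ℕ) :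
    Set (Equiv.Perm (Fin n)) :=
  {x | ∃ u ∈ youngSubgroup n I, ∃ v ∈ youngSubgroup n J, x = u * w * v}

/-- The Coxeter length of `w ∈ S_n`, i.e. its number of inversions. -/
noncomputable def invLength {n : ℕ} (w : Equiv.Perm (Fin n)) : ℕ :=
  Set.ncard {p : Fin n × Fin n | p.1 < p.2 ∧ w p.2 < w p.1}

/-- `k` is a right float of `w ∈ S_n`: a large right ascent such that neither `k - 1`
nor `k + 1` is a small right ascent. -/
def IsRightFloat {n : ℕ} (w : Equiv.Perm (Fin n)) (k : ℕ) : Prop :=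
  1 ≤ k ∧ k + 1 ≤ n ∧
    permVal w k < permVal w (k + 1) ∧
    permVal w (k + 1) ≠ permVal w k + 1 ∧
    (k = 1 ∨ permVal w k ≠ permVal w (k - 1) + 1) ∧
    (k + 1 = n ∨ permVal w (k + 2) ≠ permVal w (k + 1) + 1)

/-- `floatsCount w` is the number of floats of `w`: the number of right floats of `w`
plus the number of right floats of `w⁻¹` (i.e. the left floats of `w`). -/
noncomputable def floatsCount {n : ℕ} (w : Equiv.Perm (Fin n)) : ℕ :=
  {k : ℕ | IsRightFloat w k}.ncard + {k : ℕ | IsRightFloat w⁻¹ k}.ncard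

/-- `cNum w` is the number of distinct parabolic double cosets of `S_n` whose
minimal-length element is `w`. -/
noncomputable def cNum {n : ℕ} (w : Equiv.Perm (Fin n)) : ℕ :=
  {C : Set (Equiv.Perm (Fin n)) |
    (∃ I J : Set ℕ, C = doubleCosetS n I w J) ∧ w ∈ C ∧
    ∀ x ∈ C, x ≠ w → invLength w < invLength x}.ncard

section Blocks

open Equiv

variable {n : ℕ} {I J I' J' : Set ℕ}

open Classical in
/-- The index of the block of the `0`-indexed position `p`, when the positions are cut into
intervals by the simple reflections not in `J`. -/
noncomputable def blockIndex (J : Set ℕ) (p : Fin n) : ℕ :=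
  Nat.count (fun r => r ∉ J) (p.val + 1)

lemma blockIndex_mono (J : Set ℕ) : Monotone (blockIndex J : Fin n → ℕ) := by
  classical
  intro p q h
  exact Nat.count_monotone _ (Nat.succ_le_succ h)

lemma blockIndex_eq_iff_of_succ {p q : Fin n} (h : q.val = p.val + 1) :
    blockIndex J p = blockIndex J q ↔ q.val ∈ J := by
  classical
  unfold blockIndex
  rw [Nat.count_succ _ q.val, ← h]
  split_ifs with hq <;> simp_all

lemma blockIndex_eq_iff_of_le {p q : Fin n} (h : p ≤ q) :
    blockIndex J p = blockIndex J q ↔ ∀ r : ℕ, p.val < r → r ≤ q.val → r ∈ J := by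
  constructor
  · intro e r hpr hrq
    have hr : r < n := by omega
    have h1 := blockIndex_mono J (show p ≤ ⟨r - 1, by omega⟩ from Fin.mk_le_mk.2 (by omega))
    have h2 := blockIndex_mono J (show (⟨r, hr⟩ : Fin n) ≤ q from hrq)
    have h3 := blockIndex_mono J (show (⟨r - 1, by omega⟩ : Fin n) ≤ ⟨r, hr⟩ from
      Fin.mk_le_mk.2 (by omega))
    have := blockIndex_eq_iff_of_succ (J := J) (p := (⟨r - 1, by omega⟩ : Fin n)) (q := ⟨r, hr⟩)
      (by simp; omega)
    exact this.1 (by omega)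
  · obtain ⟨q, hq⟩ := q
    induction q with
    | zero =>
      intro _
      congr 1
      exact Fin.ext (by have : p.val ≤ 0 := h; simpa using this)
    | succ q ih =>
      intro H
      rcases Nat.lt_or_ge p.val (q + 1) with h' | h'
      · rw [ih (by omega) (Fin.mk_le_mk.2 (by omega)) fun r h1 h2 => H r h1 (by simp at *; omega)]
        exact (blockIndex_eq_iff_of_succ rfl).2 (H _ h' le_rfl)
      · congr 1
        exact Fin.ext (le_antisymm h h')

lemma blockIndex_eq_of_subset (hJ : J ⊆ J') {p q : Fin n}
    (h : blockIndex J p = blockIndex J q) : blockIndex J' p = blockIndex J' q := by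
  wlog hpq : p ≤ q generalizing p q
  · exact (this h.symm (le_of_not_ge hpq)).symm
  rw [blockIndex_eq_iff_of_le hpq] at h ⊢
  exact fun r h1 h2 => hJ (h r h1 h2)

lemma blockIndex_eq_of_mem_Icc {p q x y : Fin n} (h : blockIndex J p = blockIndex J q)
    (hx : p ≤ x) (hx' : x ≤ q) (hy : p ≤ y) (hy' : y ≤ q) :
    blockIndex J x = blockIndex J y := by
  have := blockIndex_mono J hx
  have := blockIndex_mono J hx'
  have := blockIndex_mono J hy
  have := blockIndex_mono J hy'
  omega

lemma adjT_val {p q : Fin n} (h : q.val = p.val + 1) : adjT n q.val = swap p q := by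
  have hq := q.isLt
  unfold adjT
  rw [dif_pos (by omega)]
  congr 1
  exact Fin.ext (by simp; omega)

lemma adjT_eq_one {j : ℕ} (h : ¬ (1 ≤ j ∧ j < n)) : adjT n j = 1 :=
  dif_neg fun h' => h (by omega)

lemma exists_fin_pair {j : ℕ} (h : 1 ≤ j ∧ j < n) :
    ∃ p q : Fin n, q.val = p.val + 1 ∧ q.val = j :=
  ⟨⟨j - 1, by omega⟩, ⟨j, h.2⟩, by simp; omega, rfl⟩

lemma adjT_mul_self (j : ℕ) : adjT n j * adjT n j = 1 := by
  unfold adjT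
  split_ifs <;> simp

lemma adjT_mem_youngSubgroup {j : ℕ} (h : j ∈ J) : adjT n j ∈ youngSubgroup n J :=
  Subgroup.subset_closure ⟨j, h, rfl⟩

lemma youngSubgroup_mono (h : J ⊆ J') : youngSubgroup n J ≤ youngSubgroup n J' :=
  Subgroup.closure_mono fun _ ⟨i, hi, e⟩ => ⟨i, h hi, e⟩

lemma youngSubgroup_union : youngSubgroup n (J ∪ J') = youngSubgroup n J ⊔ youngSubgroup n J' := by
  unfold youngSubgroup
  rw [← Subgroup.closure_union]
  congr 1
  ext x
  simp [or_and_right, exists_or]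

lemma youngSubgroup_inter_range :
    youngSubgroup n (J ∩ {j | 1 ≤ j ∧ j < n}) = youngSubgroup n J := by
  refine le_antisymm (youngSubgroup_mono Set.inter_subset_left) ?_
  refine (Subgroup.closure_le _).2 ?_
  rintro _ ⟨j, hj, rfl⟩
  by_cases h : 1 ≤ j ∧ j < n
  · exact adjT_mem_youngSubgroup ⟨hj, h⟩
  · rw [adjT_eq_one h]
    exact one_mem _

lemma blockIndex_apply {v : Perm (Fin n)} (hv : v ∈ youngSubgroup n J) (p : Fin n) :
    blockIndex J (v p) = blockIndex J p := by
  unfold youngSubgroup at hv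
  induction hv using Subgroup.closure_induction generalizing p with
  | mem x hx =>
    obtain ⟨j, hj, rfl⟩ := hx
    by_cases h : 1 ≤ j ∧ j < n
    · obtain ⟨a, b, hab, rfl⟩ := exists_fin_pair h
      have e := (blockIndex_eq_iff_of_succ hab).2 hj
      rw [adjT_val hab]
      rcases eq_or_ne p a with rfl | ha
      · simp [e]
      rcases eq_or_ne p b with rfl | hb
      · simp [e]
      rw [swap_apply_of_ne_of_ne ha hb]
    · rw [adjT_eq_one h]; rfl
  | one => rfl
  | mul x y _ _ hx hy => rw [Perm.mul_apply, hx, hy]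
  | inv x _ hx => rw [← hx (x⁻¹ p), ← Perm.mul_apply, mul_inv_cancel, Perm.one_apply]

lemma swap_mem_youngSubgroup {p q : Fin n} (h : blockIndex J p = blockIndex J q) :
    swap p q ∈ youngSubgroup n J := by
  wlog hpq : p ≤ q generalizing p q
  · rw [swap_comm]
    exact this h.symm (le_of_not_ge hpq)
  obtain ⟨q, hq⟩ := q
  induction q with
  | zero =>
    rw [show p = ⟨0, hq⟩ from Fin.ext (by have : p.val ≤ 0 := hpq; simpa using this), swap_self]
    exact one_mem _
  | succ q ih =>
    rcases Nat.lt_or_ge p.val (q + 1) with h' | h'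
    · have hq' : q < n := by omega
      have hle : p ≤ ⟨q, hq'⟩ := Nat.lt_succ_iff.1 h'
      have hle' : (⟨q, hq'⟩ : Fin n) ≤ ⟨q + 1, hq⟩ := Nat.le_succ q
      have e1 : blockIndex J p = blockIndex J ⟨q, hq'⟩ :=
        blockIndex_eq_of_mem_Icc h le_rfl hpq hle hle'
      have hadj : adjT n (q + 1) = swap ⟨q, hq'⟩ ⟨q + 1, hq⟩ :=
        adjT_val (n := n) (p := ⟨q, hq'⟩) (q := ⟨q + 1, hq⟩) rfl
      have hmem : swap ⟨q, hq'⟩ ⟨q + 1, hq⟩ ∈ youngSubgroup n J := by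
        rw [← hadj]
        exact adjT_mem_youngSubgroup ((blockIndex_eq_iff_of_le hpq).1 h _ h' le_rfl)
      rcases eq_or_ne p ⟨q, hq'⟩ with hpq | hne
      · rwa [hpq]
      · rw [swap_comm, ← swap_mul_swap_mul_swap (y := ⟨q, hq'⟩) hne
          (fun e => by simp [e] at h')]
        exact mul_mem (mul_mem hmem (ih _ e1 hle)) hmem
    · rw [show p = ⟨q + 1, hq⟩ from Fin.ext (le_antisymm hpq h'), swap_self]
      exact one_mem _

end Blocks

section Cosets

open Equiv
open scoped Pointwise

variable {n : ℕ} {I J I' J' : Set ℕ} {w : Perm (Fin n)}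

lemma self_mem_doubleCosetS : w ∈ doubleCosetS n I w J :=
  ⟨1, one_mem _, 1, one_mem _, by simp⟩

lemma mul_left_mem_doubleCosetS {u x : Perm (Fin n)} (hu : u ∈ youngSubgroup n I)
    (hx : x ∈ doubleCosetS n I w J) : u * x ∈ doubleCosetS n I w J := by
  obtain ⟨a, ha, b, hb, rfl⟩ := hx
  exact ⟨u * a, mul_mem hu ha, b, hb, by group⟩

lemma mul_right_mem_doubleCosetS {v x : Perm (Fin n)} (hv : v ∈ youngSubgroup n J)
    (hx : x ∈ doubleCosetS n I w J) : x * v ∈ doubleCosetS n I w J := by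
  obtain ⟨a, ha, b, hb, rfl⟩ := hx
  exact ⟨a, ha, b * v, mul_mem hb hv, by group⟩

lemma doubleCosetS_mono (hI : I ⊆ I') (hJ : J ⊆ J') :
    doubleCosetS n I w J ⊆ doubleCosetS n I' w J' := by
  rintro _ ⟨a, ha, b, hb, rfl⟩
  exact ⟨a, youngSubgroup_mono hI ha, b, youngSubgroup_mono hJ hb, rfl⟩

lemma inv_doubleCosetS : (doubleCosetS n I w J)⁻¹ = doubleCosetS n J w⁻¹ I := by
  ext x
  constructor
  · rintro ⟨a, ha, b, hb, e⟩
    exact ⟨b⁻¹, inv_mem hb, a⁻¹, inv_mem ha, by rw [← inv_inv x, e]; group⟩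
  · rintro ⟨a, ha, b, hb, rfl⟩
    exact ⟨b⁻¹, inv_mem hb, a⁻¹, inv_mem ha, by group⟩

lemma doubleCosetS_eq_iff_inv :
    doubleCosetS n I w J = doubleCosetS n I' w J' ↔
      doubleCosetS n J w⁻¹ I = doubleCosetS n J' w⁻¹ I' := by
  rw [← inv_doubleCosetS, ← inv_doubleCosetS, inv_inj]

lemma doubleCosetS_union_left (h : doubleCosetS n I w J = doubleCosetS n I' w J') :
    doubleCosetS n (I ∪ I') w J = doubleCosetS n I w J := by
  refine Set.Subset.antisymm ?_ (doubleCosetS_mono Set.subset_union_left le_rfl)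
  have key : youngSubgroup n (I ∪ I') ≤
      MulAction.stabilizer (Perm (Fin n)) (doubleCosetS n I w J) := by
    rw [youngSubgroup_union, sup_le_iff]
    constructor
    · intro u hu
      rw [MulAction.mem_stabilizer_set]
      refine fun x => ⟨fun hx => ?_, mul_left_mem_doubleCosetS hu⟩
      simpa using mul_left_mem_doubleCosetS (inv_mem hu) hx
    · intro u hu
      rw [h, MulAction.mem_stabilizer_set]
      refine fun x => ⟨fun hx => ?_, mul_left_mem_doubleCosetS hu⟩
      simpa using mul_left_mem_doubleCosetS (inv_mem hu) hx
  rintro _ ⟨a, ha, b, hb, rfl⟩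
  rw [mul_assoc]
  exact (MulAction.mem_stabilizer_set.1 (key ha) (w * b)).2
    (mul_right_mem_doubleCosetS hb self_mem_doubleCosetS)

lemma doubleCosetS_union (h : doubleCosetS n I w J = doubleCosetS n I' w J') :
    doubleCosetS n (I ∪ I') w (J ∪ J') = doubleCosetS n I w J := by
  have h1 := doubleCosetS_union_left h
  have h2 : doubleCosetS n I w (J ∪ J') = doubleCosetS n I w J :=
    doubleCosetS_eq_iff_inv.2 (doubleCosetS_union_left (doubleCosetS_eq_iff_inv.1 h))
  have h3 := doubleCosetS_union_left (h2.trans h1.symm)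
  rw [← Set.union_assoc, Set.union_self] at h3
  exact h3.trans h2

/-- The block of `J` containing the position `j` is mapped by `w` into a single block of `I`. -/
def MapsBlockIntoBlock (w : Perm (Fin n)) (I J : Set ℕ) (j : ℕ) : Prop :=
  ∀ p q r : Fin n, r.val = j → blockIndex J p = blockIndex J r → blockIndex J q = blockIndex J r →
    blockIndex I (w p) = blockIndex I (w q)

lemma doubleCosetS_eq_of_mapsBlockIntoBlock (hJ : J ⊆ J')
    (h : ∀ j ∈ J' \ J, MapsBlockIntoBlock w I J' j) :
    doubleCosetS n I w J = doubleCosetS n I w J' := by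
  refine Set.Subset.antisymm (doubleCosetS_mono le_rfl hJ) ?_
  have key : ∀ v ∈ youngSubgroup n J', w * v ∈ doubleCosetS n I w J := by
    have step : ∀ v ∈ youngSubgroup n J', ∀ j ∈ J', w * v ∈ doubleCosetS n I w J →
        w * (v * adjT n j) ∈ doubleCosetS n I w J := by
      intro v hv j hj hx
      rw [← mul_assoc]
      by_cases hjJ : j ∈ J
      · exact mul_right_mem_doubleCosetS (adjT_mem_youngSubgroup hjJ) hx
      by_cases hr : 1 ≤ j ∧ j < n
      · obtain ⟨a, b, hab, rfl⟩ := exists_fin_pair hr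
        rw [adjT_val hab, mul_swap_eq_swap_mul]
        refine mul_left_mem_doubleCosetS (swap_mem_youngSubgroup ?_) hx
        refine h _ ⟨hj, hjJ⟩ (v a) (v b) b rfl ?_ (blockIndex_apply hv b)
        rw [blockIndex_apply hv, (blockIndex_eq_iff_of_succ hab).2 hj]
      · rwa [adjT_eq_one hr, mul_one]
    intro v hv
    unfold youngSubgroup at hv
    induction hv using Subgroup.closure_induction_right with
    | one => simpa using self_mem_doubleCosetS
    | mul_right x hx y hy ih =>
      obtain ⟨j, hj, rfl⟩ := hy
      exact step x hx j hj ih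
    | mul_inv_cancel x hx y hy ih =>
      obtain ⟨j, hj, rfl⟩ := hy
      rw [inv_eq_of_mul_eq_one_right (adjT_mul_self j)]
      exact step x hx j hj ih
  rintro _ ⟨a, ha, b, hb, rfl⟩
  rw [mul_assoc]
  exact mul_left_mem_doubleCosetS ha (key b hb)

open Classical in
lemma card_filter_of_mem_doubleCosetS {x : Perm (Fin n)} (hx : x ∈ doubleCosetS n I w J)
    (c d : ℕ) :
    (Finset.univ.filter fun p => blockIndex J p < d ∧ blockIndex I (x p) = c).card =
      (Finset.univ.filter fun p => blockIndex J p < d ∧ blockIndex I (w p) = c).card := by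
  obtain ⟨u, hu, v, hv, rfl⟩ := hx
  refine Finset.card_equiv v fun p => ?_
  simp [blockIndex_apply hu, blockIndex_apply hv]

lemma mapsBlockIntoBlock_of_doubleCosetS_eq
    (h : doubleCosetS n I w J = doubleCosetS n I w J') {j : ℕ} (hj : j ∈ J' \ J)
    (hr : 1 ≤ j ∧ j < n) : MapsBlockIntoBlock w I J' j := by
  classical
  obtain ⟨a, b, hab, rfl⟩ := exists_fin_pair hr
  have hlt : blockIndex J a < blockIndex J b :=
    lt_of_le_of_ne (blockIndex_mono J (Fin.le_def.2 (by omega)))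
      fun e => hj.2 ((blockIndex_eq_iff_of_succ hab).1 e)
  have hb' : blockIndex J' a = blockIndex J' b := (blockIndex_eq_iff_of_succ hab).2 hj.1
  have key : ∀ p q : Fin n, blockIndex J' p = blockIndex J' b → blockIndex J' q = blockIndex J' b →
      p < b → b ≤ q → blockIndex I (w p) = blockIndex I (w q) := by
    intro p q hp hq hpb hbq
    by_contra hne
    have hpJ : blockIndex J p < blockIndex J b :=
      (blockIndex_mono J (Fin.le_def.2 (by rw [Fin.lt_def] at hpb; omega))).trans_lt hlt
    have hqJ := blockIndex_mono J hbq
    obtain ⟨x, hx⟩ : ∃ x, x = w * swap p q := ⟨_, rfl⟩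
    have hmem : x ∈ doubleCosetS n I w J := by
      rw [h, hx]
      exact mul_right_mem_doubleCosetS (swap_mem_youngSubgroup (hp.trans hq.symm))
        self_mem_doubleCosetS
    have hxp : x p = w q := by simp [hx]
    have hcard := card_filter_of_mem_doubleCosetS hmem (blockIndex I (w p)) (blockIndex J b)
    refine (Finset.card_lt_card ?_).ne hcard
    refine (Finset.ssubset_iff_of_subset fun y hy => ?_).2
      ⟨p, by simp [hpJ], by simp [hxp, Ne.symm hne]⟩
    simp only [Finset.mem_filter, Finset.mem_univ, true_and] at hy ⊢
    have hyq : y ≠ q := by rintro rfl; exact absurd hy.1 (not_lt.2 hqJ)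
    have hyp : y ≠ p := by rintro rfl; rw [hxp] at hy; exact hne hy.2.symm
    rwa [hx, Perm.mul_apply, swap_apply_of_ne_of_ne hyp hyq] at hy
  have hab' : a < b := Fin.lt_def.2 (by omega)
  have all : ∀ p, blockIndex J' p = blockIndex J' b →
      blockIndex I (w p) = blockIndex I (w b) := by
    intro p hp
    rcases lt_or_ge p b with hpb | hpb
    · exact key p b hp rfl hpb le_rfl
    · exact (key a p hb' hp hab' hpb).symm.trans (key a b hb' rfl hab' le_rfl)
  intro p q r hrb hp hq
  obtain rfl : r = b := Fin.ext hrb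
  exact (all p hp).trans (all q hq).symm

lemma doubleCosetS_eq_iff_of_subset (hI : I ⊆ I') (hJ : J ⊆ J')
    (hI' : I' ⊆ {j | 1 ≤ j ∧ j < n}) (hJ' : J' ⊆ {j | 1 ≤ j ∧ j < n}) :
    doubleCosetS n I w J = doubleCosetS n I' w J' ↔
      (∀ j ∈ J' \ J, MapsBlockIntoBlock w I J' j) ∧
        ∀ i ∈ I' \ I, MapsBlockIntoBlock w⁻¹ J' I' i := by
  have h1 : doubleCosetS n I w J = doubleCosetS n I w J' ↔
      ∀ j ∈ J' \ J, MapsBlockIntoBlock w I J' j :=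
    ⟨fun h j hj => mapsBlockIntoBlock_of_doubleCosetS_eq h hj (hJ' hj.1),
      doubleCosetS_eq_of_mapsBlockIntoBlock hJ⟩
  have h2 : doubleCosetS n I w J' = doubleCosetS n I' w J' ↔
      ∀ i ∈ I' \ I, MapsBlockIntoBlock w⁻¹ J' I' i := by
    rw [doubleCosetS_eq_iff_inv]
    exact ⟨fun h j hj => mapsBlockIntoBlock_of_doubleCosetS_eq h hj (hI' hj.1),
      doubleCosetS_eq_of_mapsBlockIntoBlock hI⟩
  rw [← h1, ← h2]
  refine ⟨fun h => ?_, fun h => h.1.trans h.2⟩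
  have h3 : doubleCosetS n I w J = doubleCosetS n I w J' :=
    Set.Subset.antisymm (doubleCosetS_mono le_rfl hJ) (h ▸ doubleCosetS_mono hI le_rfl)
  exact ⟨h3, h3.symm.trans h⟩

end Cosets

section Ascents

open Equiv

variable {n : ℕ} {I J : Set ℕ} {w : Perm (Fin n)}

/-- The set of right ascents of `w`. -/
def rightAscents (w : Perm (Fin n)) : Set ℕ :=
  {j | ∃ p q : Fin n, q.val = p.val + 1 ∧ q.val = j ∧ w p < w q}

lemma rightAscents_subset (w : Perm (Fin n)) : rightAscents w ⊆ {j | 1 ≤ j ∧ j < n} := by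
  rintro _ ⟨p, q, h, rfl, -⟩
  exact ⟨by omega, q.isLt⟩

lemma apply_lt_apply_of_blockIndex_eq (hJ : J ⊆ rightAscents w) {p q : Fin n} (hpq : p < q)
    (h : blockIndex J p = blockIndex J q) : w p < w q := by
  have step : ∀ a b : Fin n, b.val = a.val + 1 → b.val ∈ J → w a < w b := by
    intro a b hab hb
    obtain ⟨a', b', hab', hbb, hlt⟩ := hJ hb
    obtain rfl : b' = b := Fin.ext hbb
    obtain rfl : a' = a := Fin.ext (by omega)
    exact hlt
  obtain ⟨q, hq⟩ := q
  induction q with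
  | zero => exact absurd hpq (Nat.not_lt_zero _)
  | succ q ih =>
    have hle : p ≤ ⟨q, by omega⟩ := Nat.lt_succ_iff.1 hpq
    have hle' : (⟨q, by omega⟩ : Fin n) ≤ ⟨q + 1, hq⟩ := Nat.le_succ q
    have h1 : w ⟨q, by omega⟩ < w ⟨q + 1, hq⟩ :=
      step _ _ rfl ((blockIndex_eq_iff_of_le hpq.le).1 h _ hpq le_rfl)
    rcases hle.eq_or_lt with heq | hlt
    · rwa [heq]
    · exact (ih _ hlt (blockIndex_eq_of_mem_Icc h le_rfl hpq.le hle hle')).trans h1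

lemma lt_of_apply_lt_of_blockIndex_eq (hI : I ⊆ rightAscents w⁻¹) {p q : Fin n} (hpq : w p < w q)
    (h : blockIndex I (w p) = blockIndex I (w q)) : p < q := by
  simpa [← Perm.mul_apply] using apply_lt_apply_of_blockIndex_eq hI hpq h

/-- An ascent whose two values lie in a common block of left ascents is small. -/
lemma apply_eq_succ_of_blockIndex_eq (hI : I ⊆ rightAscents w⁻¹) {p q : Fin n}
    (hpq : q.val = p.val + 1) (hlt : w p < w q) (h : blockIndex I (w p) = blockIndex I (w q)) :
    (w q).val = (w p).val + 1 := by
  by_contra hne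
  have hlt' := Fin.lt_def.1 hlt
  obtain ⟨y, hy⟩ : ∃ y, w y = ⟨(w p).val + 1, by omega⟩ := w.surjective _
  have h1 : w p < w y := by rw [hy]; exact Nat.lt_succ_self _
  have h2 : w y < w q := by rw [hy]; exact Fin.lt_def.2 (by simp; omega)
  have h3 := lt_of_apply_lt_of_blockIndex_eq hI h1
    (blockIndex_eq_of_mem_Icc h le_rfl hlt.le h1.le h2.le)
  have h4 := lt_of_apply_lt_of_blockIndex_eq hI h2
    (blockIndex_eq_of_mem_Icc h h1.le h2.le hlt.le le_rfl)
  rw [Fin.lt_def] at h3 h4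
  omega

lemma permVal_succ (w : Perm (Fin n)) (p : Fin n) : permVal w (p.val + 1) = (w p).val + 1 := by
  unfold permVal
  rw [dif_pos (by omega)]
  rfl

lemma IsRightFloat.mem_rightAscents {k : ℕ} (h : IsRightFloat w k) : k ∈ rightAscents w := by
  obtain ⟨h1, h2, h3, -⟩ := h
  obtain ⟨p, q, hpq, rfl⟩ := exists_fin_pair (n := n) (j := k) (by omega)
  refine ⟨p, q, hpq, rfl, ?_⟩
  rw [permVal_succ, hpq, permVal_succ] at h3
  exact Fin.lt_def.2 (by omega)

lemma IsRightFloat.ne_of_apply_eq_succ {k : ℕ} (h : IsRightFloat w k) {p q : Fin n}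
    (hpq : q.val = p.val + 1) (hw : (w q).val = (w p).val + 1) :
    k ≠ q.val ∧ k ≠ q.val + 1 ∧ k + 1 ≠ q.val := by
  obtain ⟨h1, h2, -, h4, h5, h6⟩ := h
  refine ⟨?_, ?_, ?_⟩
  · rintro rfl
    rw [permVal_succ, hpq, permVal_succ] at h4
    omega
  · rintro rfl
    rw [permVal_succ, Nat.add_sub_cancel, hpq, permVal_succ] at h5
    omega
  · intro hk
    obtain rfl : k = p.val := by omega
    rw [show p.val + 2 = q.val + 1 by omega, permVal_succ, permVal_succ] at h6
    omega

lemma mapsBlockIntoBlock_diff_floats (hI : I ⊆ rightAscents w⁻¹) (hJ : J ⊆ rightAscents w)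
    {j : ℕ} (hj : j ∈ J) :
    MapsBlockIntoBlock w I J j ↔ ¬ IsRightFloat w j ∧
      MapsBlockIntoBlock w (I \ {i | IsRightFloat w⁻¹ i}) (J \ {k | IsRightFloat w k}) j := by
  obtain ⟨a, b, hab, rfl, hlt⟩ := hJ hj
  have hadj := (blockIndex_eq_iff_of_succ hab).2 hj
  set F := {k | IsRightFloat w k}
  constructor
  · intro h
    have hnf : ¬ IsRightFloat w b.val := fun hf =>
      (hf.ne_of_apply_eq_succ hab
        (apply_eq_succ_of_blockIndex_eq hI hab hlt (h a b b rfl hadj rfl))).1 rfl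
    refine ⟨hnf, fun p q r hr hp hq => ?_⟩
    have hpr := blockIndex_eq_of_subset Set.sdiff_subset hp
    have hqr := blockIndex_eq_of_subset Set.sdiff_subset hq
    have hpq := h p q r hr hpr hqr
    have hpqJ := hpr.trans hqr.symm
    clear hp hq hpr hqr
    wlog hle : p ≤ q generalizing p q
    · exact (this q p hpq.symm hpqJ.symm (le_of_not_ge hle)).symm
    have hwle : w p ≤ w q := by
      rcases hle.eq_or_lt with rfl | hl
      · exact le_rfl
      · exact (apply_lt_apply_of_blockIndex_eq hJ hl hpqJ).le
    rw [blockIndex_eq_iff_of_le hwle]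
    intro y hy1 hy2
    refine ⟨(blockIndex_eq_iff_of_le hwle).1 hpq y hy1 hy2, fun hf => ?_⟩
    have hyn : y < n := by omega
    set z : Fin n := ⟨y, hyn⟩ with hz
    set x : Fin n := ⟨y - 1, by omega⟩ with hx
    have hxz : z.val = x.val + 1 := by simp [hz, hx]; omega
    have hwp : w⁻¹ (w p) = p := by simp [← Perm.mul_apply]
    have hwq : w⁻¹ (w q) = q := by simp [← Perm.mul_apply]
    have mono : ∀ s t : Fin n, w p ≤ s → s ≤ t → t ≤ w q → w⁻¹ s ≤ w⁻¹ t := by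
      intro s t h1 h2 h3
      rcases h2.eq_or_lt with rfl | hl
      · exact le_rfl
      · exact (apply_lt_apply_of_blockIndex_eq hI hl
          (blockIndex_eq_of_mem_Icc hpq h1 (h2.trans h3) (h1.trans h2) h3)).le
    have hpx : w p ≤ x := Nat.le_sub_one_of_lt hy1
    have hzq : z ≤ w q := hy2
    have hxz' : x ≤ z := Nat.sub_le y 1
    have b1 := mono _ _ le_rfl hpx (hxz'.trans hzq)
    have b2 := mono _ _ (hpx.trans hxz') hzq le_rfl
    have b3 := mono _ _ hpx hxz' hzq
    rw [hwp] at b1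
    rw [hwq] at b2
    have hlt' : w⁻¹ x < w⁻¹ z := lt_of_le_of_ne b3 fun e => by
      have := congrArg Fin.val (w⁻¹.injective e)
      omega
    have hs := apply_eq_succ_of_blockIndex_eq (w := w⁻¹) (I := J) (by rwa [inv_inv]) hxz hlt'
      (blockIndex_eq_of_mem_Icc hpqJ b1 (b3.trans b2) (b1.trans b3) b2)
    exact (IsRightFloat.ne_of_apply_eq_succ hf hxz hs).1 rfl
  · rintro ⟨hnf, h⟩
    have small : ∀ s t : Fin n, t.val = s.val + 1 → t.val ∈ J →
        blockIndex (J \ F) s = blockIndex (J \ F) b → blockIndex (J \ F) t = blockIndex (J \ F) b →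
        (w t).val = (w s).val + 1 := by
      intro s t hst ht hs ht'
      refine apply_eq_succ_of_blockIndex_eq hI hst ?_
        (blockIndex_eq_of_subset Set.sdiff_subset (h s t b rfl hs ht'))
      exact apply_lt_apply_of_blockIndex_eq hJ (Fin.lt_def.2 (by omega))
        ((blockIndex_eq_iff_of_succ hst).2 ht)
    have key : ∀ p : Fin n, blockIndex J p = blockIndex J b →
        blockIndex (J \ F) p = blockIndex (J \ F) b := by
      intro p hp
      have hbJF : b.val ∈ J \ F := ⟨hj, hnf⟩
      rcases le_or_gt b p with hbp | hpb
      · rw [eq_comm, blockIndex_eq_iff_of_le hbp] at hp ⊢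
        intro r
        induction r using Nat.strong_induction_on with
        | _ r ih =>
          intro h1 h2
          refine ⟨hp r h1 h2, fun hf => ?_⟩
          have hrn : r - 1 < n := by omega
          have hrb : blockIndex (J \ F) (⟨r - 1, hrn⟩ : Fin n) = blockIndex (J \ F) b := by
            rw [eq_comm, blockIndex_eq_iff_of_le (Fin.le_def.2 (by simp; omega))]
            exact fun t h3 h4 => ih t (by simp at h4; omega) h3 (by simp at h4; omega)
          have hmem : r - 1 ∈ J \ F := by
            rcases Nat.eq_or_lt_of_le (show b.val ≤ r - 1 by omega) with e | e
            · rwa [← e]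
            · exact ih _ (by omega) e (by omega)
          obtain ⟨s, t, hst, htr⟩ := exists_fin_pair (n := n) (j := r - 1) (by omega)
          obtain rfl : t = ⟨r - 1, hrn⟩ := Fin.ext htr
          have hs := small s _ hst hmem.1 (by
            rw [← hrb]; exact (blockIndex_eq_iff_of_succ hst).2 hmem) hrb
          have := (IsRightFloat.ne_of_apply_eq_succ hf hst hs).2.1
          simp at this
          omega
      · rw [blockIndex_eq_iff_of_le hpb.le] at hp ⊢
        intro r h1 h2
        obtain ⟨d, hd⟩ := Nat.exists_eq_add_of_le h2
        induction d using Nat.strong_induction_on generalizing r with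
        | _ d ih =>
          refine ⟨hp r h1 h2, fun hf => ?_⟩
          have hrb' : r ≠ b.val := by rintro rfl; exact hnf hf
          have hmem : r + 1 ∈ J \ F := ih (d - 1) (by omega) (r + 1) (by omega) (by omega) (by omega)
          obtain ⟨s, t, hst, htr⟩ := exists_fin_pair (n := n) (j := r + 1) (by omega)
          have hsb : blockIndex (J \ F) s = blockIndex (J \ F) b := by
            rw [blockIndex_eq_iff_of_le (Fin.le_def.2 (by omega))]
            exact fun u h3 h4 => ih (b.val - u) (by omega) u (by omega) h4 (by omega)
          rw [← htr] at hmem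
          have hs := small s t hst hmem.1 hsb (by
            rw [← hsb]; exact ((blockIndex_eq_iff_of_succ hst).2 hmem).symm)
          exact (IsRightFloat.ne_of_apply_eq_succ hf hst hs).2.2 htr.symm
    intro p q r hr hp hq
    obtain rfl : r = b := Fin.ext hr
    exact blockIndex_eq_of_subset Set.sdiff_subset (h p q r rfl (key p hp) (key q hq))

end Ascents

section Floats

open Equiv

variable {n : ℕ} {I J I' J' : Set ℕ} {w : Perm (Fin n)}

/-- The set of right floats of `w`. -/
def rightFloats (w : Perm (Fin n)) : Set ℕ :=
  {k | IsRightFloat w k}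

lemma rightFloats_subset (w : Perm (Fin n)) : rightFloats w ⊆ rightAscents w :=
  fun _ h => IsRightFloat.mem_rightAscents h

lemma rightFloats_finite (w : Perm (Fin n)) : (rightFloats w).Finite :=
  (Set.finite_Iio n).subset fun _ h => (rightAscents_subset w (rightFloats_subset w h)).2

lemma doubleCosetS_eq_iff_floats_of_subset (hI : I ⊆ I') (hJ : J ⊆ J')
    (hI' : I' ⊆ rightAscents w⁻¹) (hJ' : J' ⊆ rightAscents w) :
    doubleCosetS n I w J = doubleCosetS n I' w J' ↔
      I ∩ rightFloats w⁻¹ = I' ∩ rightFloats w⁻¹ ∧ J ∩ rightFloats w = J' ∩ rightFloats w ∧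
      doubleCosetS n (I \ rightFloats w⁻¹) w (J \ rightFloats w) =
        doubleCosetS n (I' \ rightFloats w⁻¹) w (J' \ rightFloats w) := by
  have hIr := hI'.trans (rightAscents_subset _)
  have hJr := hJ'.trans (rightAscents_subset _)
  rw [doubleCosetS_eq_iff_of_subset hI hJ hIr hJr,
    doubleCosetS_eq_iff_of_subset (Set.sdiff_subset_sdiff_left hI)
      (Set.sdiff_subset_sdiff_left hJ)
      (Set.sdiff_subset.trans hIr) (Set.sdiff_subset.trans hJr)]
  have e1 : ∀ j ∈ J', MapsBlockIntoBlock w I J' j ↔ j ∉ rightFloats w ∧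
      MapsBlockIntoBlock w (I \ rightFloats w⁻¹) (J' \ rightFloats w) j :=
    fun j hj => mapsBlockIntoBlock_diff_floats (hI.trans hI') hJ' hj
  have e2 : ∀ i ∈ I', MapsBlockIntoBlock w⁻¹ J' I' i ↔ i ∉ rightFloats w⁻¹ ∧
      MapsBlockIntoBlock w⁻¹ (J' \ rightFloats w) (I' \ rightFloats w⁻¹) i := by
    intro i hi
    have := mapsBlockIntoBlock_diff_floats (w := w⁻¹) (I := J') (by rwa [inv_inv]) hI' hi
    rwa [inv_inv] at this
  have f1 : J ∩ rightFloats w = J' ∩ rightFloats w ↔ ∀ j ∈ J' \ J, j ∉ rightFloats w := by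
    simp only [Set.ext_iff, Set.mem_inter_iff, Set.mem_sdiff]
    exact ⟨fun h j hj hf => hj.2 ((h j).2 ⟨hj.1, hf⟩).1, fun h j => ⟨fun hj => ⟨hJ hj.1, hj.2⟩,
      fun hj => ⟨by_contra fun hn => h j ⟨hj.1, hn⟩ hj.2, hj.2⟩⟩⟩
  have f2 : I ∩ rightFloats w⁻¹ = I' ∩ rightFloats w⁻¹ ↔
      ∀ i ∈ I' \ I, i ∉ rightFloats w⁻¹ := by
    simp only [Set.ext_iff, Set.mem_inter_iff, Set.mem_sdiff]
    exact ⟨fun h j hj hf => hj.2 ((h j).2 ⟨hj.1, hf⟩).1, fun h j => ⟨fun hj => ⟨hI hj.1, hj.2⟩,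
      fun hj => ⟨by_contra fun hn => h j ⟨hj.1, hn⟩ hj.2, hj.2⟩⟩⟩
  rw [f1, f2]
  constructor
  · rintro ⟨h1, h2⟩
    exact ⟨fun i hi => ((e2 i hi.1).1 (h2 i hi)).1, fun j hj => ((e1 j hj.1).1 (h1 j hj)).1,
      fun j hj => ((e1 j hj.1.1).1 (h1 j ⟨hj.1.1, fun h => hj.2 ⟨h, hj.1.2⟩⟩)).2,
      fun i hi => ((e2 i hi.1.1).1 (h2 i ⟨hi.1.1, fun h => hi.2 ⟨h, hi.1.2⟩⟩)).2⟩
  · rintro ⟨h1, h2, h3, h4⟩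
    exact ⟨fun j hj => (e1 j hj.1).2 ⟨h2 j hj, h3 j ⟨⟨hj.1, h2 j hj⟩, fun h => hj.2 h.1⟩⟩,
      fun i hi => (e2 i hi.1).2 ⟨h1 i hi, h4 i ⟨⟨hi.1, h1 i hi⟩, fun h => hi.2 h.1⟩⟩⟩

lemma doubleCosetS_eq_iff_floats
    (hI : I ⊆ rightAscents w⁻¹) (hJ : J ⊆ rightAscents w)
    (hI' : I' ⊆ rightAscents w⁻¹) (hJ' : J' ⊆ rightAscents w) :
    doubleCosetS n I w J = doubleCosetS n I' w J' ↔
      I ∩ rightFloats w⁻¹ = I' ∩ rightFloats w⁻¹ ∧ J ∩ rightFloats w = J' ∩ rightFloats w ∧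
      doubleCosetS n (I \ rightFloats w⁻¹) w (J \ rightFloats w) =
        doubleCosetS n (I' \ rightFloats w⁻¹) w (J' \ rightFloats w) := by
  have hIU := Set.union_subset hI hI'
  have hJU := Set.union_subset hJ hJ'
  have k1 := doubleCosetS_eq_iff_floats_of_subset (w := w) (I := I) (J := J)
    Set.subset_union_left Set.subset_union_left hIU hJU
  have k2 := doubleCosetS_eq_iff_floats_of_subset (w := w) (I := I') (J := J')
    Set.subset_union_right Set.subset_union_right hIU hJU
  constructor
  · intro h
    have h' := doubleCosetS_union h
    obtain ⟨a1, a2, a3⟩ := k1.1 h'.symm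
    obtain ⟨b1, b2, b3⟩ := k2.1 (h'.trans h).symm
    exact ⟨a1.trans b1.symm, a2.trans b2.symm, a3.trans b3.symm⟩
  · rintro ⟨h1, h2, h3⟩
    have h' := doubleCosetS_union h3
    rw [← Set.union_sdiff_distrib, ← Set.union_sdiff_distrib] at h'
    refine (k1.2 ⟨?_, ?_, h'.symm⟩).trans (k2.2 ⟨?_, ?_, (h'.trans h3).symm⟩).symm
    · rw [Set.union_inter_distrib_right, ← h1, Set.union_self]
    · rw [Set.union_inter_distrib_right, ← h2, Set.union_self]
    · rw [Set.union_inter_distrib_right, ← h1, Set.union_self]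
    · rw [Set.union_inter_distrib_right, ← h2, Set.union_self]

end Floats

section Length

open Equiv

variable {n : ℕ} {I J : Set ℕ} {w x : Perm (Fin n)}

lemma invLength_inv (w : Perm (Fin n)) : invLength w⁻¹ = invLength w := by
  unfold invLength
  have e : {p : Fin n × Fin n | p.1 < p.2 ∧ w p.2 < w p.1} =
      (fun p : Fin n × Fin n => (w⁻¹ p.2, w⁻¹ p.1)) ''
        {p : Fin n × Fin n | p.1 < p.2 ∧ w⁻¹ p.2 < w⁻¹ p.1} := by
    ext ⟨a, b⟩
    constructor
    · rintro ⟨h1, h2⟩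
      exact ⟨(w b, w a), ⟨h2, by simpa [← Perm.mul_apply] using h1⟩, by simp [← Perm.mul_apply]⟩
    · rintro ⟨⟨c, d⟩, ⟨h1, h2⟩, e⟩
      simp only [Prod.mk.injEq] at e
      obtain ⟨rfl, rfl⟩ := e
      refine ⟨h2, ?_⟩
      rwa [← Perm.mul_apply, ← Perm.mul_apply, mul_inv_cancel]
  rw [e, Set.InjOn.ncard_image]
  rintro ⟨a, b⟩ _ ⟨c, d⟩ _ h
  simp only [Prod.mk.injEq, EmbeddingLike.apply_eq_iff_eq] at h
  exact Prod.ext h.2 h.1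

lemma invLength_mul_swap_lt {p q : Fin n} (hpq : q.val = p.val + 1) (h : w q < w p) :
    invLength (w * swap p q) < invLength w := by
  unfold invLength
  have hlt : p < q := Fin.lt_def.2 (by omega)
  have hne : p ≠ q := hlt.ne
  have hval : ∀ a : Fin n, (swap p q a).val =
      if a.val = p.val then q.val else if a.val = q.val then p.val else a.val := by
    intro a
    rcases eq_or_ne a p with rfl | ha
    · simp
    rcases eq_or_ne a q with rfl | hb
    · simp [hpq]
    · rw [swap_apply_of_ne_of_ne ha hb, if_neg (Fin.val_ne_of_ne ha),
        if_neg (Fin.val_ne_of_ne hb)]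
  have hinj : Set.InjOn (fun a : Fin n × Fin n => (swap p q a.1, swap p q a.2))
      {a | a.1 < a.2 ∧ (w * swap p q) a.2 < (w * swap p q) a.1} := by
    rintro ⟨a, b⟩ _ ⟨c, d⟩ _ h
    simpa using h
  rw [← hinj.ncard_image]
  refine Set.ncard_lt_ncard ?_ (Set.toFinite _)
  refine (Set.ssubset_iff_of_subset ?_).2 ⟨(p, q), ⟨hlt, h⟩, ?_⟩
  · rintro _ ⟨⟨a, b⟩, ⟨h1, h2⟩, rfl⟩
    refine ⟨?_, h2⟩
    have hab : ¬ (a = p ∧ b = q) := by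
      rintro ⟨rfl, rfl⟩
      simp only [Perm.mul_apply, swap_apply_left, swap_apply_right] at h2
      exact absurd h2 (not_lt.2 h.le)
    simp only [Fin.lt_def, Fin.ext_iff] at h1 hab ⊢
    rw [hval, hval]
    split_ifs <;> omega
  · rintro ⟨⟨a, b⟩, ⟨h1, -⟩, e⟩
    simp only [Prod.mk.injEq] at e
    simp only [Fin.lt_def, Fin.ext_iff, hval] at h1 e
    split_ifs at e <;> omega

/-- If `w` has minimal length in its right coset of `W_J`, then `J` consists of ascents. -/
lemma subset_rightAscents_of_forall_invLength_le (hJ : J ⊆ {j | 1 ≤ j ∧ j < n})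
    (h : ∀ j ∈ J, invLength w ≤ invLength (w * adjT n j)) : J ⊆ rightAscents w := by
  intro j hj
  obtain ⟨p, q, hpq, rfl⟩ := exists_fin_pair (hJ hj)
  refine ⟨p, q, hpq, rfl, ?_⟩
  by_contra hn
  have hne : w q ≠ w p := fun e => by
    have := congrArg Fin.val (w.injective e)
    omega
  have h1 := invLength_mul_swap_lt hpq (lt_of_le_of_ne (not_lt.1 hn) hne)
  have h2 := h _ hj
  rw [adjT_val hpq] at h2
  omega

lemma subset_rightAscents_inv_of_forall_invLength_le (hI : I ⊆ {i | 1 ≤ i ∧ i < n})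
    (h : ∀ i ∈ I, invLength w ≤ invLength (adjT n i * w)) : I ⊆ rightAscents w⁻¹ := by
  refine subset_rightAscents_of_forall_invLength_le hI fun i hi => ?_
  have e : w⁻¹ * adjT n i = (adjT n i * w)⁻¹ := by
    rw [mul_inv_rev, inv_eq_of_mul_eq_one_right (adjT_mul_self i)]
  rw [e, invLength_inv, invLength_inv]
  exact h i hi

/-- A function on positions which is monotone on the blocks of `J` is not changed by a
block-preserving rearrangement that is again monotone on blocks. -/
lemma comp_eq_of_monotone_on_blocks {α : Type*} [PartialOrder α] {f : Fin n → α}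
    {v : Perm (Fin n)} (hv : ∀ p, blockIndex J (v p) = blockIndex J p)
    (hf : ∀ p q, p < q → blockIndex J p = blockIndex J q → f p ≤ f q)
    (hfv : ∀ p q, p < q → blockIndex J p = blockIndex J q → f (v p) ≤ f (v q)) (p : Fin n) :
    f (v p) = f p := by
  have mono : ∀ g : Fin n → α, (∀ p q, p < q → blockIndex J p = blockIndex J q → g p ≤ g q) →
      Monotone fun p => toLex (blockIndex J p, g p) := by
    intro g hg a b hab
    rw [Prod.Lex.toLex_le_toLex]
    rcases hab.eq_or_lt with rfl | hl
    · exact Or.inr ⟨rfl, le_rfl⟩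
    rcases (blockIndex_mono J hab).lt_or_eq with h | h
    · exact Or.inl h
    · exact Or.inr ⟨h, hg a b hl h⟩
  have h1 := mono f hf
  have h2 := mono _ hfv
  have e := Tuple.unique_monotone (f := fun p => toLex (blockIndex J p, f p)) (σ := v) (τ := 1)
    (by simpa only [Function.comp_def, hv] using h2) (by simpa [Function.comp_def] using h1)
  have := congrArg (fun z => (ofLex z).2) (congrFun e p)
  simpa using this

lemma eq_of_mem_doubleCosetS (hI : I ⊆ rightAscents w⁻¹) (hJ : J ⊆ rightAscents w)
    (hIx : I ⊆ rightAscents x⁻¹) (hJx : J ⊆ rightAscents x) (hx : x ∈ doubleCosetS n I w J) :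
    x = w := by
  obtain ⟨u, hu, v, hv, e⟩ := hx
  have hxuv : ∀ p, x p = u (w (v p)) := fun p => by rw [e]; rfl
  have h1 : ∀ p, blockIndex I (w (v p)) = blockIndex I (w p) := by
    refine comp_eq_of_monotone_on_blocks (f := fun p => blockIndex I (w p)) (blockIndex_apply hv)
      (fun p q hpq h => ?_) fun p q hpq h => ?_
    · exact blockIndex_mono I (apply_lt_apply_of_blockIndex_eq hJ hpq h).le
    · have := blockIndex_mono I (apply_lt_apply_of_blockIndex_eq hJx hpq h).le
      rwa [hxuv, hxuv, blockIndex_apply hu, blockIndex_apply hu] at this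
  have h2 : ∀ y, blockIndex I ((w * x⁻¹) y) = blockIndex I y := by
    intro y
    obtain ⟨p, rfl⟩ := x.surjective y
    rw [hxuv, blockIndex_apply hu, h1, ← hxuv]
    simp [← Perm.mul_apply]
  have h3 : ∀ y, w⁻¹ ((w * x⁻¹) y) = w⁻¹ y := by
    have e' : ∀ y, w⁻¹ ((w * x⁻¹) y) = x⁻¹ y := fun y => by rw [← Perm.mul_apply]; simp
    refine comp_eq_of_monotone_on_blocks (f := fun y => w⁻¹ y) h2 (fun p q hpq h => ?_) fun p q hpq h => ?_
    · exact (apply_lt_apply_of_blockIndex_eq hI hpq h).le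
    · rw [e', e']
      exact (apply_lt_apply_of_blockIndex_eq hIx hpq h).le
  have h4 : w * x⁻¹ = 1 := Equiv.ext fun y => w⁻¹.injective (h3 y)
  exact (mul_inv_eq_one.1 h4).symm

lemma forall_invLength_lt_iff (hI : I ⊆ {i | 1 ≤ i ∧ i < n}) (hJ : J ⊆ {j | 1 ≤ j ∧ j < n}) :
    (∀ x ∈ doubleCosetS n I w J, x ≠ w → invLength w < invLength x) ↔
      I ⊆ rightAscents w⁻¹ ∧ J ⊆ rightAscents w := by
  constructor
  · intro h
    have h' : ∀ x ∈ doubleCosetS n I w J, invLength w ≤ invLength x := by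
      intro x hx
      by_cases hxw : x = w
      · rw [hxw]
      · exact (h x hx hxw).le
    exact ⟨subset_rightAscents_inv_of_forall_invLength_le hI fun i hi =>
        h' _ (mul_left_mem_doubleCosetS (adjT_mem_youngSubgroup hi) self_mem_doubleCosetS),
      subset_rightAscents_of_forall_invLength_le hJ fun j hj =>
        h' _ (mul_right_mem_doubleCosetS (adjT_mem_youngSubgroup hj) self_mem_doubleCosetS)⟩
  · rintro ⟨hIw, hJw⟩
    have min : ∀ y ∈ doubleCosetS n I w J,
        (∀ z ∈ doubleCosetS n I w J, invLength y ≤ invLength z) → y = w := fun y hy hmin =>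
      eq_of_mem_doubleCosetS hIw hJw
        (subset_rightAscents_inv_of_forall_invLength_le hI fun i hi =>
          hmin _ (mul_left_mem_doubleCosetS (adjT_mem_youngSubgroup hi) hy))
        (subset_rightAscents_of_forall_invLength_le hJ fun j hj =>
          hmin _ (mul_right_mem_doubleCosetS (adjT_mem_youngSubgroup hj) hy)) hy
    obtain ⟨y, hy, hmin⟩ := Set.exists_min_image (doubleCosetS n I w J) invLength
      (Set.toFinite _) ⟨w, self_mem_doubleCosetS⟩
    obtain rfl := min y hy hmin
    intro x hx hne
    by_contra hlt
    exact hne (min x hx fun z hz => (not_lt.1 hlt).trans (hmin z hz))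

end Length

section Counting

open Equiv

variable {n : ℕ}

lemma setOf_minimal_doubleCosetS (w : Perm (Fin n)) :
    {C : Set (Perm (Fin n)) | (∃ I J : Set ℕ, C = doubleCosetS n I w J) ∧ w ∈ C ∧
      ∀ x ∈ C, x ≠ w → invLength w < invLength x} =
    (fun P : Set ℕ × Set ℕ => doubleCosetS n P.1 w P.2) ''
      (𝒫 (rightAscents w⁻¹) ×ˢ 𝒫 (rightAscents w)) := by
  ext C
  constructor
  · rintro ⟨⟨I, J, rfl⟩, -, h⟩
    have e : doubleCosetS n (I ∩ {j | 1 ≤ j ∧ j < n}) w (J ∩ {j | 1 ≤ j ∧ j < n}) =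
        doubleCosetS n I w J := by
      unfold doubleCosetS
      rw [youngSubgroup_inter_range, youngSubgroup_inter_range]
    rw [← e] at h ⊢
    exact ⟨(_, _), (forall_invLength_lt_iff Set.inter_subset_right Set.inter_subset_right).1 h, rfl⟩
  · rintro ⟨⟨I, J⟩, ⟨hI, hJ⟩, rfl⟩
    exact ⟨⟨I, J, rfl⟩, self_mem_doubleCosetS,
      (forall_invLength_lt_iff (hI.trans (rightAscents_subset _))
        (hJ.trans (rightAscents_subset _))).2 ⟨hI, hJ⟩⟩

lemma ncard_image_eq_of_iff {α β γ : Type*} {s : Set α} {f : α → β} {g : α → γ}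
    (h : ∀ a ∈ s, ∀ b ∈ s, f a = f b ↔ g a = g b) : (f '' s).ncard = (g '' s).ncard := by
  rcases s.eq_empty_or_nonempty with rfl | ⟨a₀, _⟩
  · simp
  have : Nonempty α := ⟨a₀⟩
  have hinv : ∀ a ∈ s, Function.invFunOn f s (f a) ∈ s ∧ f (Function.invFunOn f s (f a)) = f a :=
    fun a ha => Function.invFunOn_pos ⟨a, ha, rfl⟩
  have hg : ∀ a ∈ s, g (Function.invFunOn f s (f a)) = g a := fun a ha =>
    (h _ (hinv a ha).1 a ha).1 (hinv a ha).2
  have e : g '' s = (g ∘ Function.invFunOn f s) '' (f '' s) := by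
    rw [Set.image_image]
    exact Set.image_congr fun a ha => (hg a ha).symm
  rw [e, Set.InjOn.ncard_image (s := f '' s)]
  rintro _ ⟨a, ha, rfl⟩ _ ⟨b, hb, rfl⟩ hab
  simp only [Function.comp_apply, hg a ha, hg b hb] at hab
  exact (h a ha b hb).2 hab

/-- The double cosets with minimal element `w` are parametrized by arbitrary sets of left and right
floats together with a double coset presented without floats. -/
lemma cNum_eq (w : Perm (Fin n)) :
    cNum w = 2 ^ (rightFloats w⁻¹).ncard * (2 ^ (rightFloats w).ncard *
      ((fun P : Set ℕ × Set ℕ => doubleCosetS n P.1 w P.2) ''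
        (𝒫 (rightAscents w⁻¹ \ rightFloats w⁻¹) ×ˢ 𝒫 (rightAscents w \ rightFloats w))).ncard) := by
  unfold cNum
  rw [setOf_minimal_doubleCosetS, ncard_image_eq_of_iff (g := fun P : Set ℕ × Set ℕ =>
    (P.1 ∩ rightFloats w⁻¹, P.2 ∩ rightFloats w,
      doubleCosetS n (P.1 \ rightFloats w⁻¹) w (P.2 \ rightFloats w)))]
  · rw [← Set.ncard_powerset _ (rightFloats_finite _), ← Set.ncard_powerset _ (rightFloats_finite _),
      ← Set.ncard_prod, ← Set.ncard_prod]
    congr 1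
    ext ⟨A, B, C⟩
    constructor
    · rintro ⟨⟨I, J⟩, ⟨hI, hJ⟩, e⟩
      simp only [Prod.mk.injEq] at e
      obtain ⟨rfl, rfl, rfl⟩ := e
      exact ⟨Set.inter_subset_right, Set.inter_subset_right, ⟨(_, _),
        ⟨Set.sdiff_subset_sdiff_left hI, Set.sdiff_subset_sdiff_left hJ⟩, rfl⟩⟩
    · rintro ⟨hA, hB, ⟨⟨I, J⟩, ⟨hI, hJ⟩, rfl⟩⟩
      simp only [Set.mem_powerset_iff, Set.subset_sdiff] at hA hB hI hJ
      refine ⟨(A ∪ I, B ∪ J), ⟨Set.union_subset (hA.trans (rightFloats_subset _)) hI.1,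
        Set.union_subset (hB.trans (rightFloats_subset _)) hJ.1⟩, ?_⟩
      simp only [Set.union_inter_distrib_right, Set.union_sdiff_distrib,
        Set.inter_eq_left.2 hA, Set.inter_eq_left.2 hB, hI.2.inter_eq, hJ.2.inter_eq,
        Set.sdiff_eq_empty.2 hA, Set.sdiff_eq_empty.2 hB, hI.2.sdiff_eq_left, hJ.2.sdiff_eq_left,
        Set.union_empty, Set.empty_union]
  · rintro ⟨I, J⟩ ⟨hI, hJ⟩ ⟨I', J'⟩ ⟨hI', hJ'⟩
    simp only [Prod.mk.injEq]
    exact doubleCosetS_eq_iff_floats hI hJ hI' hJ'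

end Counting

/-- For every `w ∈ S_n`, the number of parabolic double cosets with minimal element `w`
is divisible by `2 ^ |floats(w)|`. -/
theorem two_pow_floats_dvd_cNum {n : ℕ} (w : Equiv.Perm (Fin n)) :
    2 ^ floatsCount w ∣ cNum w := by
  rw [cNum_eq, floatsCount, add_comm, pow_add, ← mul_assoc]
  exact Dvd.intro _ rfl
end

section
/- Let (W,S) be a Coxeter system of finite rank, w ∈ W, and let X_L and X_R be subsets of the left and right ascent sets of w respectively. Let C = W_I w W_J be a presentation with I contained in the left ascents of w, J contained in the right ascents of w, I ∩ X_L = ∅, and J ∩ X_R = ∅. Then this presentation is lex-minimal among all (X_L, X_R)-avoiding presentations of C if and only if: (a) no connected component of J is contained in (w⁻¹ I w) ∩ S; and (b) whenever a connected component I₀ of I satisfies w⁻¹ I₀ w ⊆ S, then either some element of w⁻¹ I₀ w lies in X_R, or some element of w⁻¹ I₀ w is adjacent to but not contained in J. Moreover, every parabolic double coset admitting an (X_L, X_R)-avoiding presentation has a unique presentation that is lex-minimal among its (X_L, X_R)-avoiding presentations. -/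
open CoxeterSystem

variable {B : Type*} {W : Type*} [Group W]

/-- The standard parabolic subgroup `W_I` of a Coxeter system, generated by the
simple reflections indexed by `I`. -/
def CoxeterSystem.parabolic {M : CoxeterMatrix B} (cs : CoxeterSystem M W) (I : Set B) :
    Subgroup W :=
  Subgroup.closure (cs.simple '' I)

/-- The parabolic double coset `W_I w W_J`. -/
def CoxeterSystem.doubleCoset {M : CoxeterMatrix B} (cs : CoxeterSystem M W) (I : Set B)
    (w : W) (J : Set B) : Set W :=
  {x | ∃ u ∈ cs.parabolic I, ∃ v ∈ cs.parabolic J, x = u * w * v}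

/-- Two simple reflections are adjacent in the Coxeter graph if they are distinct and
do not commute. -/
def CoxeterSystem.adjacent {M : CoxeterMatrix B} (cs : CoxeterSystem M W) (s t : B) : Prop :=
  s ≠ t ∧ cs.simple s * cs.simple t ≠ cs.simple t * cs.simple s

/-- The connected component of `i` in the subgraph of the Coxeter graph induced by `I`. -/
def CoxeterSystem.component {M : CoxeterMatrix B} (cs : CoxeterSystem M W) (I : Set B)
    (i : B) : Set B :=
  {j | Relation.ReflTransGen (fun a b => a ∈ I ∧ b ∈ I ∧ cs.adjacent a b) i j}

/-- `(I, w, J)` is a lex-minimal `(X_L, X_R)`-avoiding presentation of the parabolic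
double coset `W_I w W_J`: it avoids `(X_L, X_R)`, `w` is the unique minimal-length
element, and `(|I|, |J|)` is lexicographically minimal among all `(X_L, X_R)`-avoiding
presentations of the coset. -/
def CoxeterSystem.IsAvoidingLexMinimal {M : CoxeterMatrix B} (cs : CoxeterSystem M W)
    (XL XR : Set B) (I : Set B) (w : W) (J : Set B) : Prop :=
  I ∩ XL = ∅ ∧ J ∩ XR = ∅ ∧
  (∀ x ∈ cs.doubleCoset I w J, x ≠ w → cs.length w < cs.length x) ∧
  (∀ (I' J' : Set B) (w' : W), cs.doubleCoset I' w' J' = cs.doubleCoset I w J →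
    I' ∩ XL = ∅ → J' ∩ XR = ∅ →
    I.ncard < I'.ncard ∨ (I.ncard = I'.ncard ∧ J.ncard ≤ J'.ncard))

open Polynomial Polynomial.Chebyshev in
/-- The polynomial coefficients in `Module.reflection_mul_reflection_pow_apply` vanish at
`2 * cos (2 * π / m)`. -/
theorem Polynomial.Chebyshev.S_mul_S_add_S_eval_eq_zero (m : ℕ) (hm : 3 ≤ m) (t : ℝ)
    (ht : t = 2 * Real.cos (2 * Real.pi / m)) :
    (S ℝ (((m : ℤ) - 2) / 2)).eval t *
        ((S ℝ (((m : ℤ) - 1) / 2)).eval t + (S ℝ (((m : ℤ) - 3) / 2)).eval t) = 0 ∧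
      (S ℝ (((m : ℤ) - 1) / 2)).eval t *
        ((S ℝ ((m : ℤ) / 2)).eval t + (S ℝ (((m : ℤ) - 2) / 2)).eval t) = 0 := by
  subst ht
  have hm' : (3 : ℝ) ≤ m := by exact_mod_cast hm
  have hsin : Real.sin (2 * Real.pi / m) ≠ 0 := by
    apply ne_of_gt
    apply Real.sin_pos_of_pos_of_lt_pi
    · positivity
    · rw [div_lt_iff₀ (by positivity)]
      nlinarith [Real.pi_pos]
  have key := fun n : ℤ => S_two_mul_real_cos (2 * Real.pi / m) n
  rcases Nat.even_or_odd' m with ⟨k, rfl | rfl⟩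
  · have hS : (S ℝ ((k : ℤ) - 1)).eval (2 * Real.cos (2 * Real.pi / (2 * k : ℕ))) = 0 := by
      have := key ((k : ℤ) - 1)
      have harg : (((k : ℤ) - 1 : ℤ) + 1 : ℝ) * (2 * Real.pi / (2 * k : ℕ)) = Real.pi := by
        have : (k : ℝ) ≠ 0 := by
          have : k ≠ 0 := by lia
          exact_mod_cast this
        push_cast
        field_simp
        ring
      rw [harg, Real.sin_pi] at this
      exact (mul_eq_zero.mp this).resolve_right hsin
    have h1 : (((2 * k : ℕ) : ℤ) - 2) / 2 = (k : ℤ) - 1 := by lia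
    have h2 : (((2 * k : ℕ) : ℤ) - 1) / 2 = (k : ℤ) - 1 := by lia
    rw [h1, h2, hS]
    simp
  · have hS : (S ℝ (k : ℤ)).eval (2 * Real.cos (2 * Real.pi / (2 * k + 1 : ℕ))) +
        (S ℝ ((k : ℤ) - 1)).eval (2 * Real.cos (2 * Real.pi / (2 * k + 1 : ℕ))) = 0 := by
      have e1 := key (k : ℤ)
      have e2 := key ((k : ℤ) - 1)
      have hk : ((2 * k + 1 : ℕ) : ℝ) ≠ 0 := by positivity
      have harg : (((k : ℤ) : ℝ) + 1) * (2 * Real.pi / (2 * k + 1 : ℕ)) =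
          2 * Real.pi - (((k : ℤ) - 1 : ℤ) + 1 : ℝ) * (2 * Real.pi / (2 * k + 1 : ℕ)) := by
        field_simp
        push_cast
        ring
      rw [harg, Real.sin_two_pi_sub] at e1
      have := congrArg₂ (· + ·) e1 e2
      simp only [← add_mul, neg_add_cancel] at this
      exact (mul_eq_zero.mp this).resolve_right hsin
    have h1 : (((2 * k + 1 : ℕ) : ℤ) - 3) / 2 = (k : ℤ) - 1 := by lia
    have h2 : (((2 * k + 1 : ℕ) : ℤ) - 1) / 2 = (k : ℤ) := by lia
    have h3 : (((2 * k + 1 : ℕ) : ℤ) - 2) / 2 = (k : ℤ) - 1 := by lia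
    have h4 : ((2 * k + 1 : ℕ) : ℤ) / 2 = (k : ℤ) := by lia
    rw [h1, h2, h3, h4, hS]
    simp

namespace CoxeterMatrix

/-- The linear form `v ↦ 2 ⟨α i, v⟩` on the geometric representation of a Coxeter matrix. -/
noncomputable def simpleCoroot (M : CoxeterMatrix B) (i : B) : Module.Dual ℝ (B →₀ ℝ) :=
  Finsupp.lsum ℝ fun j => LinearMap.lsmul ℝ ℝ (-2 * Real.cos (Real.pi / M i j))

theorem simpleCoroot_single (M : CoxeterMatrix B) (i j : B) :
    M.simpleCoroot i (Finsupp.single j 1) = -2 * Real.cos (Real.pi / M i j) := by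
  simp [simpleCoroot]

theorem simpleCoroot_single_self (M : CoxeterMatrix B) (i : B) :
    M.simpleCoroot i (Finsupp.single i 1) = 2 := by
  simp [simpleCoroot_single]

/-- The reflection by which `i` acts in the geometric representation of a Coxeter matrix. -/
noncomputable def simpleReflection (M : CoxeterMatrix B) (i : B) :
    (B →₀ ℝ) ≃ₗ[ℝ] (B →₀ ℝ) :=
  Module.reflection (M.simpleCoroot_single_self i)

theorem isLiftable_simpleReflection (M : CoxeterMatrix B) :
    M.IsLiftable M.simpleReflection := by
  intro i j
  ext1 z
  have hij := M.simpleCoroot_single i j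
  have hji := M.simpleCoroot_single j i
  rw [M.symmetric j i] at hji
  have hpow := Module.reflection_mul_reflection_pow_apply (M.simpleCoroot_single_self i)
    (M.simpleCoroot_single_self j) (M i j) z
  have ht : M.simpleCoroot i (Finsupp.single j 1) * M.simpleCoroot j (Finsupp.single i 1) - 2 =
      2 * Real.cos (2 * Real.pi / M i j) := by
    rw [hij, hji, mul_div_assoc, Real.cos_two_mul]
    ring
  rw [simpleReflection, simpleReflection, LinearEquiv.coe_one, id_eq]
  rcases lt_or_ge (M i j) 3 with hlt | hge
  · have hcases : M i j = 0 ∨ M i j = 1 ∨ M i j = 2 := by lia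
    rcases hcases with h | h | h
    · rw [h, pow_zero, LinearEquiv.coe_one, id_eq]
    · have : i = j := by
        by_contra hne
        exact M.off_diagonal i j hne h
      subst this
      rw [h, pow_one, LinearEquiv.mul_apply]
      exact Module.involutive_reflection (M.simpleCoroot_single_self i) z
    · rw [hpow, hij, hji, h]
      norm_num
      module
  · obtain ⟨h1, h2⟩ := Polynomial.Chebyshev.S_mul_S_add_S_eval_eq_zero (M i j) hge _ ht
    rw [hpow, h1, h2]
    simp

end CoxeterMatrix

namespace CoxeterSystem

theorem simple_injective {M : CoxeterMatrix B} (cs : CoxeterSystem M W) :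
    Function.Injective cs.simple := by
  intro i j h
  by_contra hij
  have hrefl : M.simpleReflection i = M.simpleReflection j := by
    rw [← cs.lift_apply_simple M.isLiftable_simpleReflection i,
      ← cs.lift_apply_simple M.isLiftable_simpleReflection j, h]
  have happ := congrArg (fun v : B →₀ ℝ => v i)
    (LinearEquiv.congr_fun hrefl (Finsupp.single i 1))
  simp only [CoxeterMatrix.simpleReflection, Module.reflection_apply,
    CoxeterMatrix.simpleCoroot_single_self, Finsupp.sub_apply, Finsupp.smul_apply,
    Finsupp.single_eq_same, Finsupp.single_eq_of_ne hij] at happ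
  norm_num at happ

section

variable {M : CoxeterMatrix B} (cs : CoxeterSystem M W)

open scoped Classical in
/-- The action of a simple reflection on signed group elements: it conjugates by `s i` and
changes the sign of `s i`. -/
noncomputable def signedConj (i : B) : Function.End (W × ZMod 2) := fun p =>
  (cs.simple i * p.1 * cs.simple i, p.2 + if p.1 = cs.simple i then 1 else 0)

open scoped Classical in
theorem signedConj_mul_pow (i j : B) (k : ℕ) (t : W) (e : ZMod 2) :
    (((cs.signedConj i * cs.signedConj j) ^ k : Function.End (W × ZMod 2)) (t, e) : W × ZMod 2) =
      ((cs.simple i * cs.simple j) ^ k * t * (cs.simple j * cs.simple i) ^ k,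
        e + ∑ n ∈ Finset.range (2 * k),
          if t = (cs.simple j * cs.simple i) ^ n * cs.simple j then 1 else 0) := by
  induction k with
  | zero => simp [Function.End.one_def]
  | succ k ih =>
    have hinv : ((cs.simple i * cs.simple j) ^ k)⁻¹ = (cs.simple j * cs.simple i) ^ k := by
      simp [← inv_pow]
    have hflip : ∀ k, cs.simple j * (cs.simple i * cs.simple j) ^ k =
        (cs.simple j * cs.simple i) ^ k * cs.simple j := fun k =>
      (mul_pow_mul (cs.simple j) (cs.simple i) k).symm
    have e1 : (cs.simple i * cs.simple j) ^ k * t * (cs.simple j * cs.simple i) ^ k = cs.simple j ↔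
        t = (cs.simple j * cs.simple i) ^ (2 * k) * cs.simple j := by
      rw [← hinv, mul_inv_eq_iff_eq_mul, ← eq_inv_mul_iff_mul_eq, hinv, hflip, two_mul, pow_add,
        mul_assoc]
    have e2 : cs.simple j * ((cs.simple i * cs.simple j) ^ k * t *
          (cs.simple j * cs.simple i) ^ k) * cs.simple j = cs.simple i ↔
        t = (cs.simple j * cs.simple i) ^ (2 * k + 1) * cs.simple j := by
      have : cs.simple j * ((cs.simple i * cs.simple j) ^ k * t *
          (cs.simple j * cs.simple i) ^ k) * cs.simple j = cs.simple i ↔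
          (cs.simple i * cs.simple j) ^ k * t * ((cs.simple i * cs.simple j) ^ k)⁻¹ =
            cs.simple j * cs.simple i * cs.simple j := by
        rw [hinv]
        constructor <;> intro h
        · have := congrArg (fun x => cs.simple j * x * cs.simple j) h
          simpa [mul_assoc] using this
        · rw [h]
          simp [mul_assoc]
      rw [this, mul_inv_eq_iff_eq_mul, ← eq_inv_mul_iff_mul_eq, hinv, mul_assoc (_ * _), hflip,
        two_mul, pow_succ, pow_add]
      have hc : cs.simple j * cs.simple i * (cs.simple j * cs.simple i) ^ k =
        (cs.simple j * cs.simple i) ^ k * (cs.simple j * cs.simple i) :=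
        (pow_succ' _ _).symm.trans (pow_succ _ _)
      rw [← mul_assoc (_ * _) ((_ * _) ^ k), hc]
      simp only [mul_assoc]
    rw [pow_succ']
    change (cs.signedConj i (cs.signedConj j
      (((cs.signedConj i * cs.signedConj j) ^ k : Function.End (W × ZMod 2)) (t, e)))) = _
    rw [ih]
    simp only [signedConj, e1, e2]
    refine Prod.ext ?_ ?_
    · simp only [pow_succ', pow_succ (cs.simple j * cs.simple i), mul_assoc]
    · simp only [mul_add, mul_one, Finset.sum_range_succ]
      ring

open scoped Classical in
theorem isLiftable_signedConj : M.IsLiftable cs.signedConj := by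
  intro i j
  funext ⟨t, e⟩
  rw [signedConj_mul_pow]
  refine Prod.ext ?_ ?_
  · simp [Function.End.one_def]
  · have : ∀ n, (if t = (cs.simple j * cs.simple i) ^ (M i j + n) * cs.simple j
          then (1 : ZMod 2) else 0) =
        if t = (cs.simple j * cs.simple i) ^ n * cs.simple j then 1 else 0 := by
      intro n
      rw [pow_add, simple_mul_simple_pow', one_mul]
    simp only [two_mul, Finset.sum_range_add, this, CharTwo.add_self_eq_zero]
    simp [Function.End.one_def]

/-- The reflection cocycle: for `x : W` and a reflection `t`, it is `1` when `t` is an inversion of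
`x⁻¹`. -/
noncomputable def inversionParity (x t : W) : ZMod 2 :=
  (cs.lift ⟨cs.signedConj, cs.isLiftable_signedConj⟩ x (t, 0)).2

theorem lift_signedConj_apply (x t : W) (e : ZMod 2) :
    cs.lift ⟨cs.signedConj, cs.isLiftable_signedConj⟩ x (t, e) =
      (x * t * x⁻¹, e + cs.inversionParity x t) := by
  induction x using cs.simple_induction_left generalizing e with
  | one => simp [inversionParity, Function.End.one_def]
  | mul_simple_left x i ih =>
    have h : ∀ e, cs.lift ⟨cs.signedConj, cs.isLiftable_signedConj⟩ (cs.simple i * x) (t, e) =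
        cs.signedConj i (x * t * x⁻¹, e + cs.inversionParity x t) := by
      intro e
      rw [map_mul, lift_apply_simple, ← ih e]
      rfl
    rw [inversionParity, h, h]
    simp [signedConj, mul_assoc, add_assoc]

theorem inversionParity_mul (x y t : W) :
    cs.inversionParity (x * y) t =
      cs.inversionParity y t + cs.inversionParity x (y * t * y⁻¹) := by
  have h : cs.lift ⟨cs.signedConj, cs.isLiftable_signedConj⟩ (x * y) (t, 0) =
      cs.lift ⟨cs.signedConj, cs.isLiftable_signedConj⟩ x
        (cs.lift ⟨cs.signedConj, cs.isLiftable_signedConj⟩ y (t, 0)) := by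
    rw [map_mul]
    rfl
  rw [lift_signedConj_apply, lift_signedConj_apply, lift_signedConj_apply] at h
  simpa using congrArg Prod.snd h

open scoped Classical in
theorem inversionParity_simple (i : B) (t : W) :
    cs.inversionParity (cs.simple i) t = if t = cs.simple i then 1 else 0 := by
  simp [inversionParity, signedConj]

theorem inversionParity_one (t : W) : cs.inversionParity 1 t = 0 := by
  simp [inversionParity, Function.End.one_def]

theorem exists_shorter_word_of_inversionParity (t : W) (ω : List B)
    (h : cs.inversionParity (cs.wordProd ω)⁻¹ t = 1) :
    ∃ ω' : List B, ω'.length + 1 = ω.length ∧ cs.wordProd ω' = t * cs.wordProd ω := by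
  induction ω using List.reverseRecOn with
  | nil => simp [inversionParity_one] at h
  | append_singleton ω i ih =>
    rw [wordProd_append, mul_inv_rev, inversionParity_mul, inv_inv, wordProd_singleton, inv_simple,
      inversionParity_simple] at h
    split_ifs at h with hi
    · refine ⟨ω, by simp, ?_⟩
      have ht : t * cs.wordProd ω = cs.wordProd ω * cs.simple i := by
        rw [← hi]
        group
      rw [wordProd_append, wordProd_singleton, ← mul_assoc, ht, mul_assoc,
        simple_mul_simple_self, mul_one]
    · obtain ⟨ω', hlen, hprod⟩ := ih (by simpa using h)
      exact ⟨ω' ++ [i], by simp [hlen], by rw [wordProd_append, wordProd_append, hprod, mul_assoc]⟩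

theorem length_mul_lt_of_inversionParity (t x : W) (h : cs.inversionParity x⁻¹ t = 1) :
    cs.length (t * x) < cs.length x := by
  obtain ⟨ω, hω, rfl⟩ := cs.exists_isReduced x
  obtain ⟨ω', hlen, hprod⟩ := cs.exists_shorter_word_of_inversionParity t ω h
  have := cs.length_wordProd_le ω'
  rw [hprod] at this
  rw [hω.eq]
  lia

theorem inversionParity_inv_eq_one_iff (r : B) (x : W) :
    cs.inversionParity x⁻¹ (cs.simple r) = 1 ↔ cs.length (cs.simple r * x) < cs.length x := by
  refine ⟨cs.length_mul_lt_of_inversionParity _ _, fun h => ?_⟩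
  by_contra hne
  have h0 : cs.inversionParity x⁻¹ (cs.simple r) = 0 := by
    generalize cs.inversionParity x⁻¹ (cs.simple r) = a at hne
    revert a
    decide
  have h1 : cs.inversionParity (cs.simple r * x)⁻¹ (cs.simple r) = 1 := by
    rw [mul_inv_rev, inv_simple, inversionParity_mul, inversionParity_simple]
    simpa using h0
  have := cs.length_mul_lt_of_inversionParity _ _ h1
  rw [simple_mul_simple_cancel_left] at this
  lia

/-- A simple reflection that becomes a left descent upon right multiplication by `s t` is
conjugate to `s t`. -/
theorem simple_mul_eq_mul_simple {r t : B} {x : W}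
    (h1 : cs.length x < cs.length (cs.simple r * x))
    (h2 : cs.length (cs.simple r * (x * cs.simple t)) < cs.length (x * cs.simple t)) :
    cs.simple r * x = x * cs.simple t := by
  have h1' := mt (cs.inversionParity_inv_eq_one_iff r x).mp h1.not_gt
  have h2' := (cs.inversionParity_inv_eq_one_iff r _).mpr h2
  rw [mul_inv_rev, inversionParity_mul, inv_simple, inversionParity_simple] at h2'
  split_ifs at h2' with h
  · rw [← h]
    group
  · exact absurd (by simpa using h2') h1'


/-! ### Exchange and length in standard parabolic subgroups -/

variable {I J K : Set B} {w x y : W}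

theorem parabolic_mono (h : I ⊆ J) : cs.parabolic I ≤ cs.parabolic J :=
  Subgroup.closure_mono (Set.image_mono h)

theorem simple_mem_parabolic {i : B} (h : i ∈ I) : cs.simple i ∈ cs.parabolic I :=
  Subgroup.subset_closure (Set.mem_image_of_mem _ h)

theorem wordProd_mem_parabolic {ω : List B} (h : ∀ i ∈ ω, i ∈ I) :
    cs.wordProd ω ∈ cs.parabolic I :=
  Subgroup.list_prod_mem _ (by simpa using fun i hi => cs.simple_mem_parabolic (h i hi))

theorem parabolic_induction_left {p : ∀ x, x ∈ cs.parabolic I → Prop} (one : p 1 (one_mem _))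
    (simple_mul : ∀ i (hi : i ∈ I) x (hx : x ∈ cs.parabolic I), p x hx →
      p (cs.simple i * x) (mul_mem (cs.simple_mem_parabolic hi) hx))
    {z : W} (hz : z ∈ cs.parabolic I) : p z hz := by
  induction hz using Subgroup.closure_induction_left with
  | one => exact one
  | mul_left _ h y hy ih =>
    obtain ⟨i, hi, rfl⟩ := h
    exact simple_mul i hi y hy ih
  | inv_mul_cancel _ h y hy ih =>
    obtain ⟨i, hi, rfl⟩ := h
    simpa only [inv_simple] using simple_mul i hi y hy ih

theorem conj_mem_of_mem_parabolic {H : Subgroup W} (g : W)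
    (h : ∀ i ∈ I, g * cs.simple i * g⁻¹ ∈ H) (hx : x ∈ cs.parabolic I) : g * x * g⁻¹ ∈ H := by
  have hle : cs.parabolic I ≤ H.comap (MulAut.conj g).toMonoidHom := by
    rw [parabolic, Subgroup.closure_le]
    rintro _ ⟨i, hi, rfl⟩
    exact h i hi
  exact hle hx

theorem commute_of_mem_parabolic {g : W} (h : ∀ i ∈ I, Commute g (cs.simple i))
    (hx : x ∈ cs.parabolic I) : Commute g x := by
  have hle : cs.parabolic I ≤ Subgroup.centralizer {g} := by
    rw [parabolic, Subgroup.closure_le]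
    rintro _ ⟨i, hi, rfl⟩
    exact Subgroup.mem_centralizer_singleton_iff.mpr (h i hi).symm.eq
  exact (Subgroup.mem_centralizer_singleton_iff.mp (hle hx)).symm

/-- In a word, one letter can be deleted when a new left descent appears. -/
theorem exists_deletion {r : B} (ω : List B) (hω : ∀ i ∈ ω, i ∈ J) (a : W)
    (h1 : cs.length a < cs.length (cs.simple r * a))
    (h2 : cs.length (cs.simple r * (a * cs.wordProd ω)) < cs.length (a * cs.wordProd ω)) :
    ∃ ω' : List B, (∀ i ∈ ω', i ∈ J) ∧ ω'.length + 1 = ω.length ∧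
      cs.simple r * (a * cs.wordProd ω) = a * cs.wordProd ω' := by
  induction ω generalizing a with
  | nil =>
    simp only [wordProd_nil, mul_one] at h2
    lia
  | cons t ω ih =>
    rw [List.forall_mem_cons] at hω
    rw [wordProd_cons, ← mul_assoc a] at h2 ⊢
    rcases lt_or_gt_of_ne (cs.length_simple_mul_ne (a * cs.simple t) r) with h | h
    · refine ⟨ω, hω.2, rfl, ?_⟩
      rw [← mul_assoc, ← mul_assoc, cs.simple_mul_eq_mul_simple h1 h,
        simple_mul_simple_cancel_right]
    · obtain ⟨ω', hJ, hlen, hprod⟩ := ih hω.2 _ h h2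
      refine ⟨t :: ω', List.forall_mem_cons.mpr ⟨hω.1, hJ⟩, by simp [hlen], ?_⟩
      rw [hprod, wordProd_cons, mul_assoc]

theorem exists_isReduced_of_mem_parabolic (hx : x ∈ cs.parabolic I) :
    ∃ ω : List B, (∀ i ∈ ω, i ∈ I) ∧ cs.IsReduced ω ∧ x = cs.wordProd ω := by
  induction hx using cs.parabolic_induction_left with
  | one => exact ⟨[], by simp, by simp [IsReduced], by simp⟩
  | simple_mul r hr x hx ih =>
    obtain ⟨ω, hI, hω, rfl⟩ := ih
    rcases cs.length_simple_mul (cs.wordProd ω) r with h | h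
    · refine ⟨r :: ω, List.forall_mem_cons.mpr ⟨hr, hI⟩, ?_, (cs.wordProd_cons _ _).symm⟩
      rw [IsReduced, wordProd_cons, h, hω.eq, List.length_cons]
    · obtain ⟨ω', hI', hlen, hprod⟩ := cs.exists_deletion (r := r) ω hI 1 (by simp)
        (by rw [one_mul]; lia)
      rw [one_mul, one_mul] at hprod
      refine ⟨ω', hI', ?_, hprod⟩
      have := hω.eq
      rw [IsReduced, ← hprod]
      lia

theorem exists_mem_parabolic_simple_mul_eq {r : B} {a : W} (hx : x ∈ cs.parabolic J)
    (h1 : cs.length a < cs.length (cs.simple r * a))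
    (h2 : cs.length (cs.simple r * (a * x)) < cs.length (a * x)) :
    ∃ x' ∈ cs.parabolic J, cs.length x' < cs.length x ∧ cs.simple r * (a * x) = a * x' := by
  obtain ⟨ω, hJ, hω, rfl⟩ := cs.exists_isReduced_of_mem_parabolic hx
  obtain ⟨ω', hJ', hlen, hprod⟩ := cs.exists_deletion ω hJ a h1 h2
  refine ⟨_, cs.wordProd_mem_parabolic hJ', ?_, hprod⟩
  have := cs.length_wordProd_le ω'
  rw [hω.eq]
  lia

theorem exists_eq_simple_of_mem_parabolic (hx : x ∈ cs.parabolic I) (h : cs.length x = 1) :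
    ∃ i ∈ I, x = cs.simple i := by
  obtain ⟨ω, hI, hω, rfl⟩ := cs.exists_isReduced_of_mem_parabolic hx
  rw [hω.eq, List.length_eq_one_iff] at h
  obtain ⟨i, rfl⟩ := h
  exact ⟨i, by simpa using hI, by simp⟩

theorem simple_mem_parabolic_iff {i : B} : cs.simple i ∈ cs.parabolic I ↔ i ∈ I := by
  refine ⟨fun h => ?_, cs.simple_mem_parabolic⟩
  obtain ⟨j, hj, hij⟩ := cs.exists_eq_simple_of_mem_parabolic h (cs.length_simple i)
  rwa [cs.simple_injective hij]

theorem mem_of_length_simple_mul_lt {r : B} (hx : x ∈ cs.parabolic I)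
    (h : cs.length (cs.simple r * x) < cs.length x) : r ∈ I := by
  obtain ⟨x', hx', -, hr⟩ := cs.exists_mem_parabolic_simple_mul_eq (r := r) (a := 1) hx (by simp)
    (by simpa using h)
  rw [one_mul, one_mul] at hr
  rw [← cs.simple_mem_parabolic_iff, ← Subgroup.mul_mem_cancel_right _ hx, hr]
  exact hx'

theorem mem_of_length_mul_simple_lt {r : B} (hx : x ∈ cs.parabolic I)
    (h : cs.length (x * cs.simple r) < cs.length x) : r ∈ I := by
  refine cs.mem_of_length_simple_mul_lt (inv_mem hx) ?_
  rwa [← cs.inv_simple, ← mul_inv_rev, length_inv, length_inv]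

/-! ### Minimal coset representatives -/

theorem length_mul_of_forall_le (h : ∀ u ∈ cs.parabolic I, cs.length w ≤ cs.length (u * w))
    (hx : x ∈ cs.parabolic I) : cs.length (x * w) = cs.length x + cs.length w := by
  obtain ⟨ω, hI, hω, rfl⟩ := cs.exists_isReduced_of_mem_parabolic hx
  clear hx
  induction ω with
  | nil => simp
  | cons r ω ih =>
    rw [List.forall_mem_cons] at hI
    have hω' : cs.IsReduced ω := by simpa using hω.drop 1
    have hlen : cs.length (cs.simple r * cs.wordProd ω) = cs.length (cs.wordProd ω) + 1 := by
      rw [← wordProd_cons, hω.eq, hω'.eq, List.length_cons]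
    have ih := ih hI.2 hω'
    have hmem := cs.wordProd_mem_parabolic hI.2
    rw [wordProd_cons, mul_assoc]
    rcases cs.length_simple_mul (cs.wordProd ω * w) r with hr | hr
    · lia
    · exfalso
      obtain ⟨w', -, hw', heq⟩ := cs.exists_mem_parabolic_simple_mul_eq (r := r)
        (a := cs.wordProd ω) (x := w) (J := Set.univ)
        (by
          rw [parabolic, Set.image_univ, cs.subgroup_closure_range_simple]
          trivial)
        (by lia) (by lia)
      have hle := h ((cs.wordProd ω)⁻¹ * cs.simple r * cs.wordProd ω)
        (mul_mem (mul_mem (inv_mem hmem) (cs.simple_mem_parabolic hI.1)) hmem)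
      rw [mul_assoc, mul_assoc, heq, inv_mul_cancel_left] at hle
      lia

theorem length_parabolic_mul (h : ∀ i ∈ I, cs.length w < cs.length (cs.simple i * w))
    (hx : x ∈ cs.parabolic I) : cs.length (x * w) = cs.length x + cs.length w := by
  refine cs.length_mul_of_forall_le (fun u hu => ?_) hx
  obtain ⟨⟨g, hg⟩, -, hmin⟩ := WellFounded.has_min
    (InvImage.wf (fun g : cs.parabolic I => cs.length (g * w)) wellFounded_lt) Set.univ ⟨1, trivial⟩
  have hmin : ∀ v ∈ cs.parabolic I, cs.length (g * w) ≤ cs.length (v * w) := fun v hv =>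
    not_lt.mp (hmin ⟨v, hv⟩ trivial)
  have hadd := fun v (hv : v ∈ cs.parabolic I) =>
    cs.length_mul_of_forall_le (w := g * w) (x := v) (fun u hu => by
      rw [← mul_assoc]
      exact hmin _ (mul_mem hu hg)) hv
  obtain rfl | hne := eq_or_ne g 1
  · simpa using hmin u hu
  · exfalso
    obtain ⟨r, hr⟩ := cs.exists_leftDescent_of_ne_one (inv_ne_one.mpr hne)
    have hrI := cs.mem_of_length_simple_mul_lt (inv_mem hg) hr
    have h1 := hadd _ (inv_mem hg)
    have h2 := hadd _ (mul_mem (cs.simple_mem_parabolic hrI) (inv_mem hg))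
    rw [inv_mul_cancel_left] at h1
    rw [mul_assoc, inv_mul_cancel_left] at h2
    have := h r hrI
    have hr : cs.length (cs.simple r * g⁻¹) < cs.length g⁻¹ := hr
    lia

theorem length_mul_parabolic (h : ∀ j ∈ J, cs.length w < cs.length (w * cs.simple j))
    (hx : x ∈ cs.parabolic J) : cs.length (w * x) = cs.length w + cs.length x := by
  have := cs.length_parabolic_mul (w := w⁻¹) (x := x⁻¹) (I := J) (fun j hj => by
    rw [← cs.inv_simple, ← mul_inv_rev, length_inv, length_inv]
    exact h j hj) (inv_mem hx)
  rw [← mul_inv_rev, length_inv, length_inv, length_inv] at this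
  lia

theorem exists_length_eq_of_mul_mul {u v : W}
    (hI : ∀ i ∈ I, cs.length w < cs.length (cs.simple i * w))
    (hJ : ∀ j ∈ J, cs.length w < cs.length (w * cs.simple j))
    (hu : u ∈ cs.parabolic I) (hv : v ∈ cs.parabolic J) :
    ∃ u' ∈ cs.parabolic I, ∃ v' ∈ cs.parabolic J, u * w * v = u' * w * v' ∧
      cs.length (u * w * v) = cs.length u' + cs.length w + cs.length v' := by
  induction hu using cs.parabolic_induction_left with
  | one =>
    exact ⟨1, one_mem _, v, hv, rfl, by simp [cs.length_mul_parabolic hJ hv]⟩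
  | simple_mul r hr u hu ih =>
    obtain ⟨u', hu', v', hv', heq, hlen⟩ := ih
    have hrw : cs.simple r * u * w * v = cs.simple r * (u' * w * v') := by
      rw [← heq]
      simp only [mul_assoc]
    have hru' := mul_mem (cs.simple_mem_parabolic hr) hu'
    rw [heq] at hlen
    rw [hrw]
    rcases cs.length_simple_mul u' r with h | h
    · rcases cs.length_simple_mul (u' * w * v') r with h' | h'
      · exact ⟨_, hru', v', hv', by simp only [mul_assoc], by lia⟩
      · have h1 := cs.length_parabolic_mul hI hu'
        have h2 := cs.length_parabolic_mul hI hru'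
        rw [mul_assoc] at h2
        obtain ⟨v'', hv'', hlt, heq'⟩ := cs.exists_mem_parabolic_simple_mul_eq (r := r)
          (a := u' * w) hv' (by lia) (by lia)
        refine ⟨u', hu', v'', hv'', heq', ?_⟩
        have h3 := cs.length_mul_le (u' * w) v''
        rw [← heq'] at h3
        lia
    · have h1 := cs.length_mul_le (cs.simple r * u' * w) v'
      have h2 := cs.length_mul_le (cs.simple r * u') w
      have h3 := cs.length_simple_mul (u' * w * v') r
      refine ⟨_, hru', v', hv', by simp only [mul_assoc], ?_⟩
      simp only [mul_assoc] at *
      lia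

theorem exists_eq_mul_of_mem_parabolic_union
    (h : ∀ i ∈ I, ∀ j ∈ J, Commute (cs.simple i) (cs.simple j))
    (hx : x ∈ cs.parabolic (I ∪ J)) : ∃ u ∈ cs.parabolic I, ∃ v ∈ cs.parabolic J, x = u * v := by
  induction hx using cs.parabolic_induction_left with
  | one => exact ⟨1, one_mem _, 1, one_mem _, by simp⟩
  | simple_mul r hr x _ ih =>
    obtain ⟨u, hu, v, hv, rfl⟩ := ih
    rcases hr with hr | hr
    · exact ⟨_, mul_mem (cs.simple_mem_parabolic hr) hu, v, hv, (mul_assoc _ _ _).symm⟩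
    · refine ⟨u, hu, _, mul_mem (cs.simple_mem_parabolic hr) hv, ?_⟩
      have := cs.commute_of_mem_parabolic (g := cs.simple r) (fun i hi => (h i hi r hr).symm) hu
      rw [← mul_assoc, this.eq, mul_assoc]

/-- The simple reflections of `I` that conjugation by `w⁻¹` sends to simple reflections of `J`. -/
def conjInter (I : Set B) (w : W) (J : Set B) : Set B :=
  {i ∈ I | ∃ j ∈ J, cs.simple j = w⁻¹ * cs.simple i * w}

theorem exists_simple_mul_eq_mul_simple {r : B} {v v' : W}
    (hr : cs.length w < cs.length (cs.simple r * w))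
    (hJ : ∀ j ∈ J, cs.length w < cs.length (w * cs.simple j))
    (hv : v ∈ cs.parabolic J) (hv' : v' ∈ cs.parabolic J) (h : cs.simple r * (w * v) = w * v') :
    ∃ j ∈ J, cs.simple j = w⁻¹ * cs.simple r * w := by
  have hmem := mul_mem hv' (inv_mem hv)
  have heq : cs.simple r * w = w * (v' * v⁻¹) := by
    rw [← mul_assoc, ← h]
    group
  have hlen := cs.length_mul_parabolic hJ hmem
  rw [← heq] at hlen
  obtain ⟨j, hj, hsj⟩ := cs.exists_eq_simple_of_mem_parabolic hmem
    (by have := cs.length_simple_mul w r; lia)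
  refine ⟨j, hj, ?_⟩
  rw [← hsj, mul_assoc, heq, inv_mul_cancel_left]

/-- Kilmoyer's theorem: `W_I ∩ w W_J w⁻¹` is a standard parabolic subgroup. -/
theorem mem_parabolic_conjInter {v : W}
    (hI : ∀ i ∈ I, cs.length w < cs.length (cs.simple i * w))
    (hJ : ∀ j ∈ J, cs.length w < cs.length (w * cs.simple j))
    (hy : y ∈ cs.parabolic I) (hv : v ∈ cs.parabolic J) (h : y * w = w * v) :
    y ∈ cs.parabolic (cs.conjInter I w J) := by
  induction hn : cs.length y generalizing y v with
  | zero =>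
    rw [cs.length_eq_zero_iff.mp hn]
    exact one_mem _
  | succ n ih =>
    have hne : y ≠ 1 := by
      rintro rfl
      simp at hn
    obtain ⟨r, hr⟩ := cs.exists_leftDescent_of_ne_one hne
    rw [isLeftDescent_iff] at hr
    have hrI := cs.mem_of_length_simple_mul_lt (r := r) hy (by lia)
    have hry := mul_mem (cs.simple_mem_parabolic hrI) hy
    have h1 := cs.length_parabolic_mul hI hy
    have h2 := cs.length_parabolic_mul hI hry
    rw [mul_assoc, h] at h2
    rw [h] at h1
    obtain ⟨v', hv', -, heq⟩ := cs.exists_mem_parabolic_simple_mul_eq hv (hI r hrI) (by lia)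
    have hmem := ih hry hv' (by rw [mul_assoc, h, heq]) (by lia)
    have hr' : r ∈ cs.conjInter I w J :=
      ⟨hrI, cs.exists_simple_mul_eq_mul_simple (hI r hrI) hJ hv hv' heq⟩
    exact (Subgroup.mul_mem_cancel_left _ (cs.simple_mem_parabolic hr')).mp hmem

theorem length_simple_mul_simple {i j : B} (h : i ≠ j) :
    cs.length (cs.simple i * cs.simple j) = 2 := by
  have h1 := cs.length_simple_mul (cs.simple j) i
  rw [cs.length_simple] at h1
  have h2 : cs.length (cs.simple i * cs.simple j) ≠ 0 := by
    rw [Ne, length_eq_zero_iff, mul_eq_one_iff_eq_inv, inv_simple]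
    exact fun hij => h (cs.simple_injective hij)
  lia

theorem commute_of_simple_eq_conj {r r' t : B} (hr : r ≠ t) (hr' : r' ≠ t)
    (h : cs.simple r' = (cs.simple t)⁻¹ * cs.simple r * cs.simple t) :
    Commute (cs.simple t) (cs.simple r) := by
  have heq : cs.simple r' * (cs.simple t * cs.simple r) = cs.simple t := by
    rw [h, inv_simple]
    simp [mul_assoc]
  have hmem : cs.simple t * cs.simple r ∈ cs.parabolic {t, r} :=
    mul_mem (cs.simple_mem_parabolic (by simp)) (cs.simple_mem_parabolic (by simp))
  have := cs.mem_of_length_simple_mul_lt hmem (r := r')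
    (by rw [heq, length_simple, cs.length_simple_mul_simple hr.symm]; norm_num)
  obtain rfl : r' = r := by simpa [hr'] using this
  rw [mul_assoc, eq_inv_mul_iff_mul_eq] at h
  exact h

theorem mem_parabolic_of_commute_simple {t : B} (ht : t ∉ I) (hy : y ∈ cs.parabolic I)
    (h : Commute (cs.simple t) y) :
    y ∈ cs.parabolic {r ∈ I | Commute (cs.simple t) (cs.simple r)} := by
  have hne : ∀ r ∈ I, r ≠ t := fun r hr hrt => ht (hrt ▸ hr)
  have hmem := cs.mem_parabolic_conjInter (w := cs.simple t)
    (fun r hr => by rw [length_simple, cs.length_simple_mul_simple (hne r hr)]; norm_num)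
    (fun r hr => by rw [length_simple, cs.length_simple_mul_simple (hne r hr).symm]; norm_num)
    hy hy h.symm
  refine cs.parabolic_mono ?_ hmem
  rintro r ⟨hr, r', hr', hconj⟩
  exact ⟨hr, cs.commute_of_simple_eq_conj (hne r hr) (hne r' hr') hconj⟩

/-- Any vertex in the component of `s` lies in the support of an element of `W_I` whose only left
descent is `s`. -/
theorem exists_unique_leftDescent_of_mem_component {s t : B} (hs : s ∈ I)
    (ht : t ∈ cs.component I s) :
    ∃ y ∈ cs.parabolic I, (∀ r, cs.length (cs.simple r * y) < cs.length y → r = s) ∧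
      ∀ K, y ∈ cs.parabolic K → t ∈ K := by
  induction ht with
  | refl =>
    refine ⟨cs.simple s, cs.simple_mem_parabolic hs, fun r hr => ?_, fun K =>
      cs.simple_mem_parabolic_iff.mp⟩
    by_contra hne
    rw [cs.length_simple_mul_simple hne, length_simple] at hr
    lia
  | @tail t t' _ htt' ih =>
    obtain ⟨y, hy, hdesc, hsupp⟩ := ih
    by_cases hcase : ∀ K, y ∈ cs.parabolic K → t' ∈ K
    · exact ⟨y, hy, hdesc, hcase⟩
    push Not at hcase
    obtain ⟨K, hyK, ht'K⟩ := hcase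
    have hlen : cs.length (y * cs.simple t') = cs.length y + 1 :=
      (cs.length_mul_simple y t').resolve_right fun h =>
        ht'K (cs.mem_of_length_mul_simple_lt hyK (by lia))
    refine ⟨y * cs.simple t', mul_mem hy (cs.simple_mem_parabolic htt'.2.1), fun r hr => ?_,
      fun L hL => cs.mem_of_length_mul_simple_lt hL (by
        rw [simple_mul_simple_cancel_right]
        lia)⟩
    rcases lt_or_gt_of_ne (cs.length_simple_mul_ne y r) with h | h
    · exact hdesc r h
    exfalso
    have heq := cs.simple_mul_eq_mul_simple h hr
    have hr' := cs.mem_of_length_simple_mul_lt (I := insert t' K)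
      (mul_mem (cs.parabolic_mono (Set.subset_insert _ _) hyK)
        (cs.simple_mem_parabolic (Set.mem_insert _ _))) hr
    rcases hr' with rfl | hrK
    · exact htt'.2.2.2 (hsupp _ (cs.mem_parabolic_of_commute_simple ht'K hyK heq)).2.symm.eq
    · apply ht'K
      rw [← cs.simple_mem_parabolic_iff, ← Subgroup.mul_mem_cancel_left _ hyK, ← heq]
      exact mul_mem (cs.simple_mem_parabolic hrK) hyK

/-! ### Presentations of parabolic double cosets -/

theorem mem_doubleCoset_self (I : Set B) (w : W) (J : Set B) : w ∈ cs.doubleCoset I w J :=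
  ⟨1, one_mem _, 1, one_mem _, by simp⟩

theorem mul_mem_doubleCoset {u : W} (hu : u ∈ cs.parabolic I) (hx : x ∈ cs.doubleCoset I w J) :
    u * x ∈ cs.doubleCoset I w J := by
  obtain ⟨u', hu', v, hv, rfl⟩ := hx
  exact ⟨u * u', mul_mem hu hu', v, hv, by simp only [mul_assoc]⟩

theorem mem_doubleCoset_mul {v : W} (hx : x ∈ cs.doubleCoset I w J) (hv : v ∈ cs.parabolic J) :
    x * v ∈ cs.doubleCoset I w J := by
  obtain ⟨u, hu, v', hv', rfl⟩ := hx
  exact ⟨u, hu, v' * v, mul_mem hv' hv, by simp only [mul_assoc]⟩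

theorem doubleCoset_subset_of_mem (hx : x ∈ cs.doubleCoset I w J) :
    cs.doubleCoset I x J ⊆ cs.doubleCoset I w J := by
  rintro _ ⟨u, hu, v, hv, rfl⟩
  exact cs.mem_doubleCoset_mul (cs.mul_mem_doubleCoset hu hx) hv

theorem doubleCoset_eq_of_mem (hx : x ∈ cs.doubleCoset I w J) :
    cs.doubleCoset I x J = cs.doubleCoset I w J := by
  refine (cs.doubleCoset_subset_of_mem hx).antisymm (cs.doubleCoset_subset_of_mem ?_)
  obtain ⟨u, hu, v, hv, rfl⟩ := hx
  exact ⟨u⁻¹, inv_mem hu, v⁻¹, inv_mem hv, by group⟩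

theorem doubleCoset_inv (I : Set B) (w : W) (J : Set B) :
    cs.doubleCoset J w⁻¹ I = (·⁻¹) '' cs.doubleCoset I w J := by
  ext x
  constructor
  · rintro ⟨v, hv, u, hu, rfl⟩
    exact ⟨_, ⟨u⁻¹, inv_mem hu, v⁻¹, inv_mem hv, rfl⟩,
      by simp only [mul_inv_rev, inv_inv, mul_assoc]⟩
  · rintro ⟨_, ⟨u, hu, v, hv, rfl⟩, rfl⟩
    exact ⟨v⁻¹, inv_mem hv, u⁻¹, inv_mem hu, by simp only [mul_inv_rev, mul_assoc]⟩

theorem length_lt_of_mem_doubleCoset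
    (hI : ∀ i ∈ I, cs.length w < cs.length (cs.simple i * w))
    (hJ : ∀ j ∈ J, cs.length w < cs.length (w * cs.simple j))
    (hx : x ∈ cs.doubleCoset I w J) (hne : x ≠ w) : cs.length w < cs.length x := by
  obtain ⟨u, hu, v, hv, rfl⟩ := hx
  obtain ⟨u', hu', v', hv', heq, hlen⟩ := cs.exists_length_eq_of_mul_mul hI hJ hu hv
  by_contra hle
  have hu1 := cs.length_eq_zero_iff.mp (show cs.length u' = 0 by lia)
  have hv1 := cs.length_eq_zero_iff.mp (show cs.length v' = 0 by lia)
  rw [heq, hu1, hv1] at hne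
  simp at hne

theorem left_ascent_of_mem_doubleCoset
    (hmin : ∀ x ∈ cs.doubleCoset I w J, cs.length w ≤ cs.length x) :
    ∀ i ∈ I, cs.length w < cs.length (cs.simple i * w) := fun i hi =>
  lt_of_le_of_ne (hmin _ (cs.mul_mem_doubleCoset (cs.simple_mem_parabolic hi)
    (cs.mem_doubleCoset_self I w J))) (cs.length_simple_mul_ne w i).symm

theorem right_ascent_of_mem_doubleCoset
    (hmin : ∀ x ∈ cs.doubleCoset I w J, cs.length w ≤ cs.length x) :
    ∀ j ∈ J, cs.length w < cs.length (w * cs.simple j) := fun j hj =>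
  lt_of_le_of_ne (hmin _ (cs.mem_doubleCoset_mul (cs.mem_doubleCoset_self I w J)
    (cs.simple_mem_parabolic hj))) (cs.length_mul_simple_ne w j).symm

theorem component_mono (h : I ⊆ J) (i : B) : cs.component I i ⊆ cs.component J i := fun _ hj =>
  Relation.ReflTransGen.mono (fun _ _ hab => ⟨h hab.1, h hab.2.1, hab.2.2⟩) _ _ hj

theorem component_subset {i : B} (hi : i ∈ I) : cs.component I i ⊆ I := by
  intro j hj
  induction hj with
  | refl => exact hi
  | tail _ h _ => exact h.2.1

theorem mem_component_self (I : Set B) (i : B) : i ∈ cs.component I i :=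
  Relation.ReflTransGen.refl

theorem mem_component_of_adjacent {i a b : B} (ha : a ∈ cs.component I i) (haI : a ∈ I)
    (hbI : b ∈ I) (hab : cs.adjacent a b) : b ∈ cs.component I i :=
  Relation.ReflTransGen.tail ha ⟨haI, hbI, hab⟩

theorem commute_of_not_adjacent {i j : B} (h : ¬ cs.adjacent i j) :
    Commute (cs.simple i) (cs.simple j) := by
  by_contra hc
  exact h ⟨fun hij => hc (hij ▸ Commute.refl _), hc⟩

theorem exists_simple_eq_conj_of_mem_component {I' J' : Set B}
    (hI : ∀ i ∈ I, cs.length w < cs.length (cs.simple i * w))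
    (hJ : ∀ j ∈ J, cs.length w < cs.length (w * cs.simple j))
    (hI' : ∀ i ∈ I', cs.length w < cs.length (cs.simple i * w))
    (h : cs.doubleCoset I' w J' = cs.doubleCoset I w J) {s t : B} (hsI' : s ∈ I') (hsI : s ∉ I)
    (ht : t ∈ cs.component (I ∪ I') s) : ∃ j ∈ J, cs.simple j = w⁻¹ * cs.simple t * w := by
  have hU : ∀ i ∈ I ∪ I', cs.length w < cs.length (cs.simple i * w) := fun i hi =>
    hi.elim (hI i) (hI' i)
  obtain ⟨y, hy, hdesc, hsupp⟩ := cs.exists_unique_leftDescent_of_mem_component (Or.inr hsI') ht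
  have hyC : y * w ∈ cs.doubleCoset I w J := by
    clear hdesc hsupp
    induction hy using cs.parabolic_induction_left with
    | one => simpa using cs.mem_doubleCoset_self I w J
    | simple_mul r hr x hx ih =>
      rw [mul_assoc]
      rcases hr with hr | hr
      · exact cs.mul_mem_doubleCoset (cs.simple_mem_parabolic hr) ih
      · rw [← h] at ih ⊢
        exact cs.mul_mem_doubleCoset (cs.simple_mem_parabolic hr) ih
  obtain ⟨u, hu, v, hv, heq⟩ := hyC
  obtain ⟨u', hu', v', hv', heq', hlen⟩ := cs.exists_length_eq_of_mul_mul hI hJ hu hv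
  obtain rfl : u' = 1 := by
    by_contra hne
    obtain ⟨r, hr⟩ := cs.exists_leftDescent_of_ne_one hne
    rw [isLeftDescent_iff] at hr
    have hrI := cs.mem_of_length_simple_mul_lt (r := r) hu' (by lia)
    have hry := mul_mem (cs.simple_mem_parabolic (Or.inl hrI : r ∈ I ∪ I')) hy
    have h1 := cs.length_parabolic_mul hU hy
    have h2 := cs.length_parabolic_mul hU hry
    have h3 : cs.simple r * y * w = cs.simple r * u' * w * v' := by
      rw [mul_assoc, heq, heq']
      simp only [mul_assoc]
    have h4 := cs.length_mul_le (cs.simple r * u' * w) v'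
    have h5 := cs.length_mul_le (cs.simple r * u') w
    rw [← heq] at hlen
    rw [← h3] at h4
    exact hsI (hdesc r (by lia) ▸ hrI)
  rw [heq', one_mul] at heq
  exact (hsupp _ (cs.mem_parabolic_conjInter hU hJ hy hv' heq)).2

theorem exists_simple_eq_conj_of_mem_component_right {I' J' : Set B}
    (hI : ∀ i ∈ I, cs.length w < cs.length (cs.simple i * w))
    (hJ : ∀ j ∈ J, cs.length w < cs.length (w * cs.simple j))
    (hJ' : ∀ j ∈ J', cs.length w < cs.length (w * cs.simple j))
    (h : cs.doubleCoset I' w J' = cs.doubleCoset I w J) {s t : B} (hsJ' : s ∈ J') (hsJ : s ∉ J)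
    (ht : t ∈ cs.component (J ∪ J') s) : ∃ i ∈ I, cs.simple t = w⁻¹ * cs.simple i * w := by
  have hinv : ∀ i, cs.length (cs.simple i * w⁻¹) = cs.length (w * cs.simple i) := fun i => by
    rw [← length_inv, mul_inv_rev, inv_inv, inv_simple]
  have hinv' : ∀ i, cs.length (w⁻¹ * cs.simple i) = cs.length (cs.simple i * w) := fun i => by
    rw [← length_inv, mul_inv_rev, inv_inv, inv_simple]
  obtain ⟨i, hi, hconj⟩ := cs.exists_simple_eq_conj_of_mem_component (w := w⁻¹) (I := J) (J := I)
    (I' := J') (J' := I')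
    (fun j hj => by rw [length_inv, hinv]; exact hJ j hj)
    (fun i hi => by rw [length_inv, hinv']; exact hI i hi)
    (fun j hj => by rw [length_inv, hinv]; exact hJ' j hj)
    (by rw [doubleCoset_inv, doubleCoset_inv, h]) hsJ' hsJ ht
  refine ⟨i, hi, ?_⟩
  rw [hconj]
  group

/-! ### Lex-minimality -/

theorem subset_of_doubleCoset_eq {I' J' XR : Set B}
    (hI : ∀ i ∈ I, cs.length w < cs.length (cs.simple i * w))
    (hJ : ∀ j ∈ J, cs.length w < cs.length (w * cs.simple j))
    (hI' : ∀ i ∈ I', cs.length w < cs.length (cs.simple i * w))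
    (hJ' : ∀ j ∈ J', cs.length w < cs.length (w * cs.simple j))
    (h : cs.doubleCoset I' w J' = cs.doubleCoset I w J) (hJX : J' ∩ XR = ∅)
    (hcompJ : ∀ j ∈ J, ¬ cs.component J j ⊆ {s | ∃ t ∈ I, cs.simple s = w⁻¹ * cs.simple t * w})
    (hcompI : ∀ i ∈ I, (∀ a ∈ cs.component I i, ∃ b, cs.simple b = w⁻¹ * cs.simple a * w) →
      ((∃ b ∈ {b : B | ∃ a ∈ cs.component I i, cs.simple b = w⁻¹ * cs.simple a * w}, b ∈ XR) ∨
        (∃ b ∈ {b : B | ∃ a ∈ cs.component I i, cs.simple b = w⁻¹ * cs.simple a * w},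
          b ∉ J ∧ ∃ j ∈ J, cs.adjacent b j))) : I ⊆ I' := by
  intro s hs
  by_contra hsI'
  have hconj : ∀ a ∈ cs.component I s, ∃ b ∈ J', cs.simple b = w⁻¹ * cs.simple a * w :=
    fun a ha => cs.exists_simple_eq_conj_of_mem_component hI' hJ' hI h.symm hs hsI'
      (cs.component_mono Set.subset_union_right s ha)
  have hmem : ∀ b, (∃ a ∈ cs.component I s, cs.simple b = w⁻¹ * cs.simple a * w) → b ∈ J' := by
    rintro b ⟨a, ha, hb⟩
    obtain ⟨b', hb', heq⟩ := hconj a ha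
    rwa [cs.simple_injective (hb.trans heq.symm)]
  rcases hcompI s hs fun a ha => (hconj a ha).imp fun _ hb => hb.2 with
    ⟨b, hb, hbX⟩ | ⟨b, hb, hbJ, j, hj, hadj⟩
  · exact Set.eq_empty_iff_forall_notMem.mp hJX b ⟨hmem b hb, hbX⟩
  · refine hcompJ j hj fun t ht => cs.exists_simple_eq_conj_of_mem_component_right hI hJ hJ' h
      (hmem b hb) hbJ ?_
    exact Relation.ReflTransGen.trans
      (cs.mem_component_of_adjacent (cs.mem_component_self _ b) (Or.inr (hmem b hb)) (Or.inl hj)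
        hadj)
      (cs.component_mono Set.subset_union_left j ht)

theorem subset_of_doubleCoset_eq_right {J' : Set B}
    (hI : ∀ i ∈ I, cs.length w < cs.length (cs.simple i * w))
    (hJ : ∀ j ∈ J, cs.length w < cs.length (w * cs.simple j))
    (hJ' : ∀ j ∈ J', cs.length w < cs.length (w * cs.simple j))
    (h : cs.doubleCoset I w J' = cs.doubleCoset I w J)
    (hcompJ : ∀ j ∈ J, ¬ cs.component J j ⊆ {s | ∃ t ∈ I, cs.simple s = w⁻¹ * cs.simple t * w}) :
    J ⊆ J' := by
  intro s hs
  by_contra hsJ'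
  exact hcompJ s hs fun t ht => cs.exists_simple_eq_conj_of_mem_component_right hI hJ' hJ h.symm
    hs hsJ' (cs.component_mono Set.subset_union_right s ht)

theorem commute_of_mem_component {i a b : B} (hi : i ∈ I) (ha : a ∈ cs.component I i)
    (hb : b ∈ I \ cs.component I i) : Commute (cs.simple a) (cs.simple b) :=
  cs.commute_of_not_adjacent fun hab =>
    hb.2 (cs.mem_component_of_adjacent ha (cs.component_subset hi ha) hb.1 hab)

theorem doubleCoset_sdiff_component {j : B} (hj : j ∈ J)
    (h : cs.component J j ⊆ {s | ∃ t ∈ I, cs.simple s = w⁻¹ * cs.simple t * w}) :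
    cs.doubleCoset I w (J \ cs.component J j) = cs.doubleCoset I w J := by
  refine Set.Subset.antisymm ?_ ?_
  · rintro _ ⟨u, hu, v, hv, rfl⟩
    exact ⟨u, hu, v, cs.parabolic_mono Set.sdiff_subset hv, rfl⟩
  · rintro _ ⟨u, hu, v, hv, rfl⟩
    rw [← Set.union_sdiff_cancel (cs.component_subset hj)] at hv
    obtain ⟨v₀, hv₀, v₁, hv₁, rfl⟩ := cs.exists_eq_mul_of_mem_parabolic_union
      (fun a ha b hb => cs.commute_of_mem_component hj ha hb) hv
    have hconj : w * v₀ * w⁻¹ ∈ cs.parabolic I := by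
      refine cs.conj_mem_of_mem_parabolic w (fun s hs => ?_) hv₀
      obtain ⟨t, ht, hst⟩ := h hs
      rw [hst]
      convert cs.simple_mem_parabolic ht using 1
      group
    exact ⟨_, mul_mem hu hconj, v₁, hv₁, by group⟩

theorem doubleCoset_sdiff_component_union {i : B} (hi : i ∈ I)
    (hconj : ∀ a ∈ cs.component I i, ∃ b, cs.simple b = w⁻¹ * cs.simple a * w)
    (hadj : ∀ b, (∃ a ∈ cs.component I i, cs.simple b = w⁻¹ * cs.simple a * w) → b ∉ J →
      ∀ j ∈ J, ¬ cs.adjacent b j) :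
    cs.doubleCoset (I \ cs.component I i) w
      (J ∪ {b | ∃ a ∈ cs.component I i, cs.simple b = w⁻¹ * cs.simple a * w}) =
      cs.doubleCoset I w J := by
  set K := {b | ∃ a ∈ cs.component I i, cs.simple b = w⁻¹ * cs.simple a * w}
  refine Set.Subset.antisymm ?_ ?_
  · rintro _ ⟨u, hu, v, hv, rfl⟩
    rw [Set.union_comm, ← Set.sdiff_union_self] at hv
    obtain ⟨v₀, hv₀, v₁, hv₁, rfl⟩ := cs.exists_eq_mul_of_mem_parabolic_union
      (fun b hb j hj => cs.commute_of_not_adjacent (hadj b hb.1 hb.2 j hj)) hv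
    have hmem : w * v₀ * w⁻¹ ∈ cs.parabolic I := by
      refine cs.conj_mem_of_mem_parabolic w (fun s hs => ?_) hv₀
      obtain ⟨t, ht, hst⟩ := hs.1
      rw [hst]
      convert cs.simple_mem_parabolic (cs.component_subset hi ht) using 1
      group
    exact ⟨_, mul_mem (cs.parabolic_mono Set.sdiff_subset hu) hmem, v₁, hv₁, by group⟩
  · rintro _ ⟨u, hu, v, hv, rfl⟩
    rw [← Set.sdiff_union_of_subset (cs.component_subset hi)] at hu
    obtain ⟨u₁, hu₁, u₀, hu₀, rfl⟩ := cs.exists_eq_mul_of_mem_parabolic_union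
      (fun b hb a ha => (cs.commute_of_mem_component hi ha hb).symm) hu
    have hmem : w⁻¹ * u₀ * w⁻¹⁻¹ ∈ cs.parabolic (J ∪ K) := by
      refine cs.conj_mem_of_mem_parabolic w⁻¹ (fun a ha => ?_) hu₀
      obtain ⟨b, hb⟩ := hconj a ha
      rw [inv_inv, ← hb]
      exact cs.simple_mem_parabolic (Or.inr ⟨a, ha, hb⟩)
    exact ⟨u₁, hu₁, _, mul_mem hmem (cs.parabolic_mono Set.subset_union_left hv), by group⟩

theorem isAvoidingLexMinimal_iff [Finite B] {XL XR : Set B}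
    (hI : ∀ i ∈ I, cs.length w < cs.length (cs.simple i * w))
    (hJ : ∀ j ∈ J, cs.length w < cs.length (w * cs.simple j))
    (hIX : I ∩ XL = ∅) (hJX : J ∩ XR = ∅) :
    cs.IsAvoidingLexMinimal XL XR I w J ↔
      ((∀ j ∈ J, ¬ (cs.component J j ⊆
          {s : B | ∃ t ∈ I, cs.simple s = w⁻¹ * cs.simple t * w})) ∧
       (∀ i ∈ I, (∀ a ∈ cs.component I i, ∃ b : B, cs.simple b = w⁻¹ * cs.simple a * w) →
          ((∃ b ∈ {b : B | ∃ a ∈ cs.component I i,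
              cs.simple b = w⁻¹ * cs.simple a * w}, b ∈ XR) ∨
           (∃ b ∈ {b : B | ∃ a ∈ cs.component I i,
              cs.simple b = w⁻¹ * cs.simple a * w}, b ∉ J ∧ ∃ j ∈ J, cs.adjacent b j)))) := by
  have hlt : ∀ (K : Set B), ∀ k ∈ K, (K \ cs.component K k).ncard < K.ncard := fun K k hk =>
    Set.ncard_lt_ncard (Set.sdiff_subset.ssubset_of_mem_notMem hk
      fun h => h.2 (cs.mem_component_self K k)) K.toFinite
  constructor
  · rintro ⟨-, -, -, hmin⟩
    refine ⟨fun j hj hsub => ?_, fun i hi hconj => ?_⟩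
    · have := hmin I _ w (cs.doubleCoset_sdiff_component hj hsub) hIX
        (Set.subset_eq_empty (Set.inter_subset_inter_left _ Set.sdiff_subset) hJX)
      have := hlt J j hj
      lia
    · by_contra! hcon
      have := hmin _ _ w
        (cs.doubleCoset_sdiff_component_union hi hconj fun b hb hbJ => hcon.2 b hb hbJ)
        (Set.subset_eq_empty (Set.inter_subset_inter_left _ Set.sdiff_subset) hIX)
        (by
          rw [Set.union_inter_distrib_right, hJX, Set.empty_union]
          exact Set.eq_empty_iff_forall_notMem.mpr fun b hb => hcon.1 b hb.1 hb.2)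
      have := hlt I i hi
      lia
  · rintro ⟨hcompJ, hcompI⟩
    refine ⟨hIX, hJX, fun x => cs.length_lt_of_mem_doubleCoset hI hJ, ?_⟩
    intro I' J' w' h _ hJX'
    have h' : cs.doubleCoset I' w J' = cs.doubleCoset I w J := by
      rw [← h]
      exact cs.doubleCoset_eq_of_mem (h ▸ cs.mem_doubleCoset_self I w J)
    have hmin : ∀ x ∈ cs.doubleCoset I' w J', cs.length w ≤ cs.length x := by
      intro x hx
      rw [h'] at hx
      obtain rfl | hne := eq_or_ne x w
      · rfl
      · exact (cs.length_lt_of_mem_doubleCoset hI hJ hx hne).le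
    have hI' := cs.left_ascent_of_mem_doubleCoset hmin
    have hJ' := cs.right_ascent_of_mem_doubleCoset hmin
    have hsub := cs.subset_of_doubleCoset_eq hI hJ hI' hJ' h' hJX' hcompJ hcompI
    obtain rfl | hne := eq_or_ne I I'
    · exact Or.inr ⟨rfl, Set.ncard_le_ncard
        (cs.subset_of_doubleCoset_eq_right hI hJ hJ' h' hcompJ) J'.toFinite⟩
    · exact Or.inl (Set.ncard_lt_ncard (hsub.ssubset_of_ne hne) I'.toFinite)

theorem isAvoidingLexMinimal_eq [Finite B] {XL XR I' J' : Set B} {w' : W}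
    (h : cs.IsAvoidingLexMinimal XL XR I w J) (h' : cs.IsAvoidingLexMinimal XL XR I' w' J')
    (hC : cs.doubleCoset I w J = cs.doubleCoset I' w' J') : (I, w, J) = (I', w', J') := by
  obtain rfl : w = w' := by
    by_contra hne
    have h1 := h.2.2.1 w' (hC ▸ cs.mem_doubleCoset_self I' w' J') (Ne.symm hne)
    have h2 := h'.2.2.1 w (hC ▸ cs.mem_doubleCoset_self I w J) hne
    lia
  have hle : ∀ {I J}, cs.IsAvoidingLexMinimal XL XR I w J →
      ∀ x ∈ cs.doubleCoset I w J, cs.length w ≤ cs.length x := by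
    intro I J h x hx
    obtain rfl | hne := eq_or_ne x w
    · rfl
    · exact (h.2.2.1 x hx hne).le
  have hI := cs.left_ascent_of_mem_doubleCoset (hle h)
  have hJ := cs.right_ascent_of_mem_doubleCoset (hle h)
  have hI' := cs.left_ascent_of_mem_doubleCoset (hle h')
  have hJ' := cs.right_ascent_of_mem_doubleCoset (hle h')
  have hcard := h.2.2.2 I' J' w hC.symm h'.1 h'.2.1
  have hcard' := h'.2.2.2 I J w hC h.1 h.2.1
  obtain ⟨hcompJ, hcompI⟩ := (cs.isAvoidingLexMinimal_iff hI hJ h.1 h.2.1).mp h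
  obtain rfl : I = I' := Set.eq_of_subset_of_ncard_le
    (cs.subset_of_doubleCoset_eq hI hJ hI' hJ' hC.symm h'.2.1 hcompJ hcompI) (by lia) I'.toFinite
  obtain rfl : J = J' := Set.eq_of_subset_of_ncard_le
    (cs.subset_of_doubleCoset_eq_right hI hJ hJ' hC.symm hcompJ) (by lia) J'.toFinite
  rfl

theorem exists_isAvoidingLexMinimal {XL XR : Set B} (hIX : I ∩ XL = ∅) (hJX : J ∩ XR = ∅) :
    ∃ I' w' J', cs.doubleCoset I w J = cs.doubleCoset I' w' J' ∧
      cs.IsAvoidingLexMinimal XL XR I' w' J' := by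
  obtain ⟨x, hx, hxmin⟩ := WellFounded.has_min (InvImage.wf cs.length wellFounded_lt)
    (cs.doubleCoset I w J) ⟨w, cs.mem_doubleCoset_self I w J⟩
  have hxmin : ∀ y ∈ cs.doubleCoset I x J, cs.length x ≤ cs.length y := fun y hy =>
    not_lt.mp (hxmin y (cs.doubleCoset_subset_of_mem hx hy))
  rw [← cs.doubleCoset_eq_of_mem hx]
  obtain ⟨⟨I', J'⟩, ⟨hC, hI'X, hJ'X⟩, hmin⟩ := WellFounded.has_min
    (InvImage.wf (fun p : Set B × Set B => toLex (p.1.ncard, p.2.ncard)) wellFounded_lt)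
    {p | cs.doubleCoset I x J = cs.doubleCoset p.1 x p.2 ∧ p.1 ∩ XL = ∅ ∧ p.2 ∩ XR = ∅}
    ⟨(I, J), rfl, hIX, hJX⟩
  refine ⟨I', x, J', hC, hI'X, hJ'X, fun y => ?_, fun I'' J'' w'' h hI'' hJ'' => ?_⟩
  · rw [hC] at hxmin
    exact cs.length_lt_of_mem_doubleCoset (cs.left_ascent_of_mem_doubleCoset hxmin)
      (cs.right_ascent_of_mem_doubleCoset hxmin)
  · have hx'' : cs.doubleCoset I'' x J'' = cs.doubleCoset I'' w'' J'' :=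
      cs.doubleCoset_eq_of_mem (h ▸ cs.mem_doubleCoset_self I' x J')
    have := hmin (I'', J'') ⟨hC.trans (h.symm.trans hx''.symm), hI'', hJ''⟩
    simp only [InvImage, Prod.Lex.toLex_lt_toLex] at this
    lia

end

end CoxeterSystem
/-- Characterization of lex-minimal `(X_L, X_R)`-avoiding presentations, together with
the existence and uniqueness of such presentations for every coset admitting an
`(X_L, X_R)`-avoiding presentation. -/
theorem avoiding_lex_minimal_characterization
    [Fintype B] {M : CoxeterMatrix B} (cs : CoxeterSystem M W)
    (XL XR : Set B) (w : W)
    (hXL : ∀ s ∈ XL, cs.length w < cs.length (cs.simple s * w))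
    (hXR : ∀ s ∈ XR, cs.length w < cs.length (w * cs.simple s))
    (I J : Set B)
    (hI : ∀ s ∈ I, cs.length w < cs.length (cs.simple s * w))
    (hJ : ∀ s ∈ J, cs.length w < cs.length (w * cs.simple s))
    (hIX : I ∩ XL = ∅) (hJX : J ∩ XR = ∅) :
    (cs.IsAvoidingLexMinimal XL XR I w J ↔
      ((∀ j ∈ J, ¬ (cs.component J j ⊆
          {s : B | ∃ t ∈ I, cs.simple s = w⁻¹ * cs.simple t * w})) ∧
       (∀ i ∈ I, (∀ a ∈ cs.component I i, ∃ b : B, cs.simple b = w⁻¹ * cs.simple a * w) →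
          ((∃ b ∈ {b : B | ∃ a ∈ cs.component I i,
              cs.simple b = w⁻¹ * cs.simple a * w}, b ∈ XR) ∨
           (∃ b ∈ {b : B | ∃ a ∈ cs.component I i,
              cs.simple b = w⁻¹ * cs.simple a * w}, b ∉ J ∧ ∃ j ∈ J, cs.adjacent b j))))) ∧
    (∀ C : Set W,
      (∃ (I' : Set B) (w' : W) (J' : Set B),
        C = cs.doubleCoset I' w' J' ∧ I' ∩ XL = ∅ ∧ J' ∩ XR = ∅) →
      ∃! p : Set B × W × Set B,
        C = cs.doubleCoset p.1 p.2.1 p.2.2 ∧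
        cs.IsAvoidingLexMinimal XL XR p.1 p.2.1 p.2.2) := by
  refine ⟨cs.isAvoidingLexMinimal_iff hI hJ hIX hJX, ?_⟩
  rintro _ ⟨I', w', J', rfl, hI'X, hJ'X⟩
  obtain ⟨I₀, w₀, J₀, hC, hmin⟩ := cs.exists_isAvoidingLexMinimal hI'X hJ'X
  exact ⟨(I₀, w₀, J₀), ⟨hC, hmin⟩, fun _ h =>
    cs.isAvoidingLexMinimal_eq h.2 hmin (h.1.symm.trans hC)⟩
end
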